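/- Suppose there exists a σ-field 𝒳 ⊆ ℬ such that: (1) 𝒳 ⊆ T^{−1}𝒳; (2) ess sup_{u ∈ 𝕌_0} |E[ℓ_0(u) | 𝒴_{−∞,0} ∨ T^{−n}𝒳] − ℓ_0(u)| → 0 in L¹(P) and ess sup_{u ∈ 𝕌_0} |E[ℓ_0(u) | 𝒴_{−∞,0} ∨ T^{n}𝒳] − E[ℓ_0(u) | ⋂_{k=1}^∞ (𝒴_{−∞,0} ∨ T^{k}𝒳)]| → 0 in L¹(P) as n → ∞; (3) L* := E[ess inf_{u ∈ 𝕌_0} E[ℓ_0(u) | 𝒴_{−∞,0}]] = E[ess inf_{u ∈ 𝕌_0} E[ℓ_0(u) | ⋂_{k=1}^∞ (𝒴_{−∞,0} ∨ T^{k}𝒳)]]. Then there exists an admissible strategy u* such that for every admissible strategy u, liminf_{T→∞} (L_T(u) − L_T(u*)) ≥ 0 almost surely, and moreover L_T(u*) → L* almost surely as T → ∞; in particular u* is pathwise optimal and L* is the optimal long time-average loss. -/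

import Mathlib

open MeasureTheory Filter Set
open scoped ENNReal Topology symmDiff

noncomputable section

namespace ErgodicDecisions

variable {Ω U : Type*}

/-- The `ℤ`-indexed iterates of an invertible transformation `T` with inverse `S`:
`iter T S n = Tⁿ` for `n ≥ 0` and `iter T S (-n) = Sⁿ`. -/
def iter (T S : Ω → Ω) : ℤ → Ω → Ω
  | Int.ofNat n => T^[n]
  | Int.negSucc n => S^[n + 1]

variable {m0 : MeasurableSpace Ω} [mU : MeasurableSpace U]

/-- The observation σ-field `𝒴_{m,n} = ⋁_{k=m}^{n} T^{-k} 𝒴`. -/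
def obsField (T S : Ω → Ω) (Y : MeasurableSpace Ω) (m n : ℤ) : MeasurableSpace Ω :=
  ⨆ k ∈ Set.Icc m n, MeasurableSpace.comap (iter T S k) Y

/-- The observation σ-field `𝒴_{-∞,n} = ⋁_{k ≤ n} T^{-k} 𝒴`. -/
def obsFieldLE (T S : Ω → Ω) (Y : MeasurableSpace Ω) (n : ℤ) : MeasurableSpace Ω :=
  ⨆ k ∈ Set.Iic n, MeasurableSpace.comap (iter T S k) Y

/-- `𝕌_{m,n}`: the set of `𝒴_{m,n}`-measurable decision maps `Ω → U`. -/
def Umn (T S : Ω → Ω) (Y : MeasurableSpace Ω) (m n : ℤ) : Set (Ω → U) :=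
  {v | Measurable[obsField T S Y m n] v}

/-- `𝕌_n = ⋃_{m ≤ n} 𝕌_{m,n}`. -/
def Un (T S : Ω → Ω) (Y : MeasurableSpace Ω) (n : ℤ) : Set (Ω → U) :=
  ⋃ m ∈ Set.Iic n, Umn T S Y m n

/-- The loss at time `n` of the decision map `v`: `ℓ_n(v)(ω) = ℓ(v(ω), Tⁿω)`. -/
def lossAt (T S : Ω → Ω) (ℓ : U → Ω → ℝ) (n : ℤ) (v : Ω → U) (ω : Ω) : ℝ :=
  ℓ (v ω) (iter T S n ω)

/-- An admissible strategy: `u_k` is `𝒴_{0,k}`-measurable for every `k ≥ 1`. -/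
def Admissible (T S : Ω → Ω) (Y : MeasurableSpace Ω) (u : ℕ → Ω → U) : Prop :=
  ∀ k : ℕ, 1 ≤ k → u k ∈ Umn T S Y 0 (k : ℤ)

/-- The time-average loss `L_T(u) = T⁻¹ ∑_{k=1}^T ℓ_k(u_k)`. -/
def avgLoss (T S : Ω → Ω) (ℓ : U → Ω → ℝ) (u : ℕ → Ω → U) (n : ℕ) (ω : Ω) : ℝ :=
  (n : ℝ)⁻¹ * ∑ k ∈ Finset.Icc 1 n, lossAt T S ℓ (k : ℤ) (u k) ω

/-- `g` is an essential infimum (an a.e.-greatest lower bound among random variables)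
of the family `(f i)_{i ∈ S₀}` under `P`. -/
def IsEssInfFam {ι : Type*} (P : Measure Ω) (S₀ : Set ι) (f : ι → Ω → ℝ) (g : Ω → ℝ) : Prop :=
  Measurable[m0] g ∧ (∀ i ∈ S₀, ∀ᵐ ω ∂P, g ω ≤ f i ω) ∧
    ∀ h : Ω → ℝ, Measurable[m0] h → (∀ i ∈ S₀, ∀ᵐ ω ∂P, h ω ≤ f i ω) → ∀ᵐ ω ∂P, h ω ≤ g ω

/-- `g` is an essential supremum (an a.e.-least upper bound among random variables)
of the family `(f i)_{i ∈ S₀}` under `P`. -/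
def IsEssSupFam {ι : Type*} (P : Measure Ω) (S₀ : Set ι) (f : ι → Ω → ℝ) (g : Ω → ℝ) : Prop :=
  Measurable[m0] g ∧ (∀ i ∈ S₀, ∀ᵐ ω ∂P, f i ω ≤ g ω) ∧
    ∀ h : Ω → ℝ, Measurable[m0] h → (∀ i ∈ S₀, ∀ᵐ ω ∂P, f i ω ≤ h ω) → ∀ᵐ ω ∂P, g ω ≤ h ω

/-- A mean-optimal strategy in the sense of Lemma 2.5 of the paper:
`E[ℓ_k(ũ_k)|𝒴_{0,k}] ≤ ess inf_{u ∈ 𝕌_{0,k}} E[ℓ_k(u)|𝒴_{0,k}] + 1/k` a.s. for all `k ≥ 1`. -/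
def MeanOptimalStrategy (P : Measure Ω) (T S : Ω → Ω) (Y : MeasurableSpace Ω)
    (ℓ : U → Ω → ℝ) (ut : ℕ → Ω → U) : Prop :=
  Admissible T S Y ut ∧
    ∀ k : ℕ, 1 ≤ k → ∃ g : Ω → ℝ,
      IsEssInfFam P (Umn T S Y 0 (k : ℤ))
        (fun v => P[lossAt T S ℓ (k : ℤ) v | obsField T S Y 0 (k : ℤ)]) g ∧
      ∀ᵐ ω ∂P, (P[lossAt T S ℓ (k : ℤ) (ut k) | obsField T S Y 0 (k : ℤ)]) ω ≤ g ω + (k : ℝ)⁻¹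

/-- Pathwise optimality (Definition 2.2). -/
def PathwiseOptimal (P : Measure Ω) (T S : Ω → Ω) (Y : MeasurableSpace Ω)
    (ℓ : U → Ω → ℝ) (us : ℕ → Ω → U) : Prop :=
  Admissible T S Y us ∧
    ∀ u : ℕ → Ω → U, Admissible T S Y u →
      ∀ᵐ ω ∂P,
        0 ≤ Filter.liminf (fun n : ℕ => avgLoss T S ℓ u n ω - avgLoss T S ℓ us n ω) atTop

/-- Weak pathwise optimality (Definition 2.3). -/
def WeaklyPathwiseOptimal (P : Measure Ω) (T S : Ω → Ω) (Y : MeasurableSpace Ω)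
    (ℓ : U → Ω → ℝ) (us : ℕ → Ω → U) : Prop :=
  Admissible T S Y us ∧
    ∀ u : ℕ → Ω → U, Admissible T S Y u → ∀ ε : ℝ, 0 < ε →
      Tendsto (fun n : ℕ => P {ω | -ε ≤ avgLoss T S ℓ u n ω - avgLoss T S ℓ us n ω})
        atTop (𝓝 1)

/-- Mean optimality (Definition 2.4). -/
def MeanOptimal (P : Measure Ω) (T S : Ω → Ω) (Y : MeasurableSpace Ω)
    (ℓ : U → Ω → ℝ) (us : ℕ → Ω → U) : Prop :=
  Admissible T S Y us ∧
    ∀ u : ℕ → Ω → U, Admissible T S Y u →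
      0 ≤ Filter.liminf
        (fun n : ℕ => (∫ ω, avgLoss T S ℓ u n ω ∂P) - ∫ ω, avgLoss T S ℓ us n ω ∂P) atTop

/-- Two σ-fields on `Ω` agree modulo `P`-null sets. -/
def EqModP (P : Measure Ω) (m₁ m₂ : MeasurableSpace Ω) : Prop :=
  (∀ A : Set Ω, MeasurableSet[m₁] A → ∃ B : Set Ω, MeasurableSet[m₂] B ∧ P (A ∆ B) = 0) ∧
    ∀ A : Set Ω, MeasurableSet[m₂] A → ∃ B : Set Ω, MeasurableSet[m₁] B ∧ P (A ∆ B) = 0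

/-- Conditional K-automorphism relative to `Z` (Definition 1.4); `S` is the inverse of `T`,
so that `T^{-k}𝒳 = comap T^k 𝒳` and `T^{k}𝒳 = comap S^k 𝒳`. -/
def CondK (P : Measure Ω) (T S : Ω → Ω) (Z : MeasurableSpace Ω) : Prop :=
  ∃ X : MeasurableSpace Ω, X ≤ m0 ∧
    X ≤ MeasurableSpace.comap T X ∧
    EqModP P (⨆ k : ℕ, MeasurableSpace.comap (T^[k + 1]) X) m0 ∧
    EqModP P (⨅ k : ℕ, Z ⊔ MeasurableSpace.comap (S^[k + 1]) X) Z

/-- Conditional weak mixing relative to `Z` (Definition 1.3); `S` is the inverse of `T`,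
so that `T^k B = (S^[k])⁻¹ B`. -/
def CondWeakMixing (P : Measure Ω) (S : Ω → Ω) (Z : MeasurableSpace Ω) : Prop :=
  ∀ A B : Set Ω, MeasurableSet[m0] A → MeasurableSet[m0] B →
    Tendsto
      (fun n : ℕ => ∫ ω,
        (n : ℝ)⁻¹ * ∑ k ∈ Finset.Icc 1 n,
          |(P[(A ∩ S^[k] ⁻¹' B).indicator (fun _ => (1 : ℝ)) | Z]) ω -
            (P[A.indicator (fun _ => (1 : ℝ)) | Z]) ω *
              (P[(S^[k] ⁻¹' B).indicator (fun _ => (1 : ℝ)) | Z]) ω| ∂P)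
      atTop (𝓝 0)

/-- The tail σ-field `⋂_{k≥1} (𝒴_{-∞,0} ∨ T^k 𝒳)`. -/
def tailField (T S : Ω → Ω) (Y X : MeasurableSpace Ω) : MeasurableSpace Ω :=
  ⨅ k : ℕ, obsFieldLE T S Y 0 ⊔ MeasurableSpace.comap (S^[k + 1]) X

/-- The truncated loss `ℓ_0(v)·1_{Λ ≤ M}`. -/
def truncLoss (ℓ : U → Ω → ℝ) (Λ : Ω → ℝ) (M : ℝ) (v : Ω → U) (ω : Ω) : ℝ :=
  if Λ ω ≤ M then ℓ (v ω) ω else 0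

/-- `ℓ̄_0^M(v) = ℓ_0(v)·1_{Λ≤M} − E[ℓ_0(v)·1_{Λ≤M} | 𝒴_{-∞,0}]`. -/
def barLoss (P : Measure Ω) (T S : Ω → Ω) (Y : MeasurableSpace Ω)
    (ℓ : U → Ω → ℝ) (Λ : Ω → ℝ) (M : ℝ) (v : Ω → U) (ω : Ω) : ℝ :=
  truncLoss ℓ Λ M v ω - (P[truncLoss ℓ Λ M v | obsFieldLE T S Y 0]) ω

/-- The uniform conditional mixing assumption of Theorem 2.12:
`lim_{M→∞} limsup_{T→∞} E[(1/T)∑_{k=1}^T ess sup_{u,u'∈𝕌₀}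
|E[(ℓ̄₀^M(u)∘T^{-k})·ℓ̄₀^M(u')|𝒴_{-∞,0}]|] = 0`. -/
def UniformCondMixing (P : Measure Ω) (T S : Ω → Ω) (Y : MeasurableSpace Ω)
    (ℓ : U → Ω → ℝ) (Λ : Ω → ℝ) : Prop :=
  ∃ G : ℝ → ℕ → Ω → ℝ,
    (∀ (M : ℝ) (k : ℕ),
      IsEssSupFam P ((Un T S Y 0) ×ˢ (Un T S Y 0))
        (fun p ω =>
          |(P[(fun ω' => barLoss P T S Y ℓ Λ M p.1 (S^[k] ω') *
                barLoss P T S Y ℓ Λ M p.2 ω') | obsFieldLE T S Y 0]) ω|)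
        (G M k)) ∧
    Tendsto
      (fun M : ℝ =>
        Filter.limsup
          (fun n : ℕ => ∫ ω, (n : ℝ)⁻¹ * ∑ k ∈ Finset.Icc 1 n, G M k ω ∂P) atTop)
      atTop (𝓝 0)

/-- Equimeasurability of the loss (Definition 3.1): for every `ε > 0` there is a set of
probability at least `1-ε` on which the family `{ℓ(u,·) : u ∈ U}` is totally bounded
in `L^∞(P)`. -/
def Equimeasurable (P : Measure Ω) (ℓ : U → Ω → ℝ) : Prop :=
  ∀ ε : ℝ, 0 < ε → ∃ Ωε : Set Ω, MeasurableSet[m0] Ωε ∧ 1 - ENNReal.ofReal ε ≤ P Ωε ∧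
    ∀ δ : ℝ, 0 < δ → ∃ 𝒩 : Finset (Ω → ℝ), ∀ u : U, ∃ f ∈ 𝒩,
      eLpNorm (fun ω => Ωε.indicator (ℓ u) ω - f ω) ⊤ P ≤ ENNReal.ofReal δ



/-- Auxiliary maximal functions in the proof of the ergodic theorem. -/
def maxF (T : Ω → Ω) (f : Ω → ℝ) : ℕ → Ω → ℝ
  | 0 => f
  | n + 1 => fun x => f x + max 0 (maxF T f n (T x))

lemma maxF_mono (T : Ω → Ω) (f : Ω → ℝ) (n : ℕ) (x : Ω) : maxF T f n x ≤ maxF T f (n + 1) x := by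
  induction n generalizing x with
  | zero => simp [maxF]
  | succ n ih =>
    simp only [maxF]
    have := ih (T x)
    simp only [maxF] at this
    gcongr

lemma sum_le_maxF (T : Ω → Ω) (f : Ω → ℝ) (n : ℕ) (x : Ω) :
    ∑ k ∈ Finset.range (n + 1), f (T^[k] x) ≤ maxF T f n x := by
  induction n generalizing x with
  | zero => simp [maxF]
  | succ n ih =>
    rw [Finset.sum_range_succ']
    simp only [maxF, Function.iterate_succ_apply, Function.iterate_zero_apply]
    have := ih (T x)
    have := le_max_right 0 (maxF T f n (T x))
    linarith

lemma birk_bdd (P : Measure Ω) [IsProbabilityMeasure P] (T : Ω → Ω) (hT : Ergodic T P)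
    (f : Ω → ℝ) (hfm : Measurable f) (hf : Integrable f P) (hneg : ∫ x, f x ∂P < 0) :
    ∀ᵐ x ∂P, ∃ K : ℝ, ∀ n, ∑ k ∈ Finset.range n, f (T^[k] x) ≤ K := by
  have hTm := hT.measurable
  have hm : ∀ n, Measurable (maxF T f n) := by
    intro n
    induction n with
    | zero => exact hfm
    | succ n ih => exact hfm.add (measurable_const.max (ih.comp hTm))
  have hi : ∀ n, Integrable (maxF T f n) P := by
    intro n
    induction n with
    | zero => exact hf
    | succ n ih =>
      have h1 : Integrable (fun x => maxF T f n (T x)) P :=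
        hT.toMeasurePreserving.integrable_comp_of_integrable ih
      exact hf.add ((integrable_const (0:ℝ)).sup h1)
  set A : Set Ω := {x | ∀ K : ℕ, ∃ n, (K : ℝ) < maxF T f n x} with hA
  have hAm : MeasurableSet A := by
    have : A = ⋂ K : ℕ, ⋃ n, {x | (K : ℝ) < maxF T f n x} := by ext; simp [hA]
    rw [this]
    exact MeasurableSet.iInter fun K => MeasurableSet.iUnion fun n =>
      measurableSet_lt measurable_const (hm n)
  have hAinv : T ⁻¹' A = A := by
    ext x
    simp only [hA, mem_preimage, mem_ofPred_eq]
    constructor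
    · intro h K
      obtain ⟨L, hL⟩ := exists_nat_gt ((K : ℝ) - f x)
      obtain ⟨n, hn⟩ := h L
      refine ⟨n + 1, ?_⟩
      simp only [maxF]
      have := le_max_right 0 (maxF T f n (T x))
      linarith
    · intro h K
      obtain ⟨L, hL⟩ := exists_nat_gt ((K : ℝ) + |f x|)
      obtain ⟨n, hn⟩ := h L
      have h2 := hn.trans_le (maxF_mono T f n x)
      simp only [maxF] at h2
      refine ⟨n, ?_⟩
      have h3 := le_abs_self (f x)
      rcases max_cases 0 (maxF T f n (T x)) with h4 | h4
      · have : (0:ℝ) ≤ K := Nat.cast_nonneg K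
        linarith
      · linarith
  have key : ∫ x, f x ∂P < 0 → ¬ (A =ᵐ[P] univ) := by
    intro hneg hAu
    have hAu' : ∀ᵐ x ∂P, x ∈ A := by
      filter_upwards [hAu] with x hx
      have : (A x) = (univ x) := hx
      exact this.mpr trivial
    have hlim : Tendsto (fun n => ∫ x, (maxF T f (n + 1) x - maxF T f n (T x)) ∂P) atTop
        (𝓝 (∫ x, f x ∂P)) := by
      refine tendsto_integral_of_dominated_convergence
        (fun x => |f x| + |f (T x)|) (fun n => ?_) ?_ (fun n => ?_) ?_
      · exact ((hm (n+1)).sub ((hm n).comp hTm)).aestronglyMeasurable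
      · exact hf.abs.add (hT.toMeasurePreserving.integrable_comp_of_integrable hf.abs)
      · refine ae_of_all _ fun x => ?_
        simp only [maxF, Real.norm_eq_abs]
        have h0 : f (T x) ≤ maxF T f n (T x) := by
          have : Monotone (fun n => maxF T f n (T x)) := monotone_nat_of_le_succ fun n => maxF_mono T f n _
          exact this (Nat.zero_le n)
        have a1 := neg_abs_le (f x)
        have a2 := le_abs_self (f x)
        have a3 := neg_abs_le (f (T x))
        have a4 := abs_nonneg (f (T x))
        rw [abs_le]
        rcases max_cases 0 (maxF T f n (T x)) with h4 | h4 <;> constructor <;> linarith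
      · filter_upwards [hAu'] with x hx
        have hx' : T x ∈ A := by
          have : x ∈ T ⁻¹' A := by rw [hAinv]; exact hx
          exact this
        obtain ⟨N, hN⟩ := hx' 0
        refine tendsto_const_nhds.congr' ?_
        filter_upwards [eventually_ge_atTop N] with n hn
        have : Monotone (fun n => maxF T f n (T x)) := monotone_nat_of_le_succ fun n => maxF_mono T f n _
        have h5 := this hn
        simp only [Nat.cast_zero] at hN h5
        simp only [maxF]
        rw [max_eq_right (by linarith)]
        ring
    have hge : ∀ n, 0 ≤ ∫ x, (maxF T f (n + 1) x - maxF T f n (T x)) ∂P := by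
      intro n
      have hcomp : Integrable (fun x => maxF T f n (T x)) P :=
        hT.toMeasurePreserving.integrable_comp_of_integrable (hi n)
      rw [integral_sub (hi _) hcomp]
      have h6 : ∫ x, maxF T f n (T x) ∂P = ∫ x, maxF T f n x ∂P := by
        have := integral_map (μ := P) hTm.aemeasurable (f := maxF T f n) (hm n).aestronglyMeasurable
        rw [hT.toMeasurePreserving.map_eq] at this
        exact this.symm
      rw [h6, sub_nonneg]
      exact integral_mono (hi n) (hi (n+1)) (maxF_mono T f n)
    exact absurd (ge_of_tendsto' hlim hge) (not_le.mpr hneg)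
  rcases hT.toPreErgodic.ae_empty_or_univ hAm hAinv with h | h
  · have hAu' : ∀ᵐ x ∂P, x ∉ A := by
      filter_upwards [h] with x hx
      have : (A x) = ((∅ : Set Ω) x) := hx
      exact fun hxA => this.mp hxA
    filter_upwards [hAu'] with x hx
    simp only [hA, mem_ofPred_eq, not_forall, not_exists, not_lt] at hx
    obtain ⟨K, hK⟩ := hx
    refine ⟨K, fun n => ?_⟩
    rcases n with _ | n
    · simp
    · exact (sum_le_maxF T f n x).trans (hK n)
  · exact absurd h (key hneg)

lemma birk_upper (P : Measure Ω) [IsProbabilityMeasure P] (T : Ω → Ω) (hT : Ergodic T P)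
    (f : Ω → ℝ) (hf : Integrable f P) (c : ℝ) (hc : ∫ x, f x ∂P < c) :
    ∀ᵐ x ∂P, ∀ᶠ n : ℕ in atTop, (n : ℝ)⁻¹ * ∑ k ∈ Finset.Icc 1 n, f (T^[k] x) ≤ c := by
  obtain ⟨f', hf'm, hff'⟩ := hf.aestronglyMeasurable
  have hall : ∀ᵐ x ∂P, ∀ k : ℕ, f (T^[k] x) = f' (T^[k] x) := by
    rw [ae_all_iff]
    intro k
    exact (hT.toMeasurePreserving.iterate k).quasiMeasurePreserving.ae_eq_comp hff'
  obtain ⟨d, hd1, hd2⟩ := exists_between hc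
  have hint : Integrable f' P := hf.congr hff'
  have hb := birk_bdd P T hT (fun x => f' x - d) (hf'm.measurable.sub_const d)
    (hint.sub (integrable_const d)) (by
      rw [integral_sub hint (integrable_const d), ← integral_congr_ae hff']
      simp; linarith)
  have hb2 := (hT.toMeasurePreserving).quasiMeasurePreserving.ae hb
  filter_upwards [hall, hb2] with x hx hbx
  obtain ⟨K, hK⟩ := hbx
  have hlim : Tendsto (fun n : ℕ => (n : ℝ)⁻¹ * K + d) atTop (𝓝 (0 * K + d)) :=
    (tendsto_inv_atTop_nhds_zero_nat.mul_const K).add_const d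
  rw [zero_mul, zero_add] at hlim
  filter_upwards [hlim.eventually (gt_mem_nhds hd2), eventually_gt_atTop 0] with n hn hn0
  have hs : ∑ k ∈ Finset.Icc 1 n, f (T^[k] x) = ∑ k ∈ Finset.range n, f' (T^[k] (T x)) := by
    rw [Finset.range_eq_Ico, ← Finset.Ico_add_one_right_eq_Icc, Finset.sum_Ico_eq_sum_range,
      Finset.sum_Ico_eq_sum_range]
    refine Finset.sum_congr (by simp) fun k _ => ?_
    rw [hx, ← Function.iterate_succ_apply]
    congr 2
    omega
  have hKn := hK n
  rw [Finset.sum_sub_distrib, Finset.sum_const, Finset.card_range, nsmul_eq_mul] at hKn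
  rw [hs]
  have hn0' : (0:ℝ) < n := by exact_mod_cast hn0
  calc (n : ℝ)⁻¹ * ∑ k ∈ Finset.range n, f' (T^[k] (T x)) ≤ (n:ℝ)⁻¹ * (K + n * d) := by
        gcongr; linarith
    _ = (n : ℝ)⁻¹ * K + d := by field_simp
    _ ≤ c := hn.le

lemma tendsto_of_eps (P : Measure Ω) (a : ℕ → Ω → ℝ)
    (h : ∀ ε : ℝ, 0 < ε → ∀ᵐ x ∂P, ∀ᶠ n : ℕ in atTop, |a n x| ≤ ε) :
    ∀ᵐ x ∂P, Tendsto (fun n => a n x) atTop (𝓝 0) := by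
  have h' : ∀ᵐ x ∂P, ∀ i : ℕ, ∀ᶠ n : ℕ in atTop, |a n x| ≤ 1 / ((i : ℝ) + 1) := by
    rw [ae_all_iff]; intro i; exact h _ Nat.one_div_pos_of_nat
  filter_upwards [h'] with x hx
  rw [Metric.tendsto_atTop']
  intro ε hε
  obtain ⟨i, hi⟩ := exists_nat_one_div_lt hε
  obtain ⟨N, hN⟩ := eventually_atTop.mp (hx i)
  refine ⟨N, fun n hn => ?_⟩
  rw [Real.dist_0_eq_abs]
  exact (hN n hn.le).trans_lt hi

lemma birk (P : Measure Ω) [IsProbabilityMeasure P] (T : Ω → Ω) (hT : Ergodic T P)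
    (f : Ω → ℝ) (hf : Integrable f P) :
    ∀ᵐ x ∂P, Tendsto (fun n : ℕ => (n : ℝ)⁻¹ * ∑ k ∈ Finset.Icc 1 n, f (T^[k] x)) atTop
      (𝓝 (∫ x, f x ∂P)) := by
  have h := tendsto_of_eps P
    (fun n x => (n : ℝ)⁻¹ * ∑ k ∈ Finset.Icc 1 n, f (T^[k] x) - ∫ x, f x ∂P) (by
      intro ε hε
      filter_upwards [birk_upper P T hT f hf (∫ x, f x ∂P + ε) (by linarith),
        birk_upper P T hT (fun x => - f x) hf.neg (- ∫ x, f x ∂P + ε)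
          (by rw [integral_neg]; linarith)] with x h1 h2
      filter_upwards [h1, h2] with n h1 h2
      simp only [Finset.sum_neg_distrib, mul_neg] at h2
      rw [abs_le]; constructor <;> linarith)
  filter_upwards [h] with x hx
  simpa using hx.add_const (∫ x, f x ∂P)

/-- Strong law for bounded orthogonal sequences. -/
lemma slln_orth (P : Measure Ω) [IsProbabilityMeasure P] (D : ℕ → Ω → ℝ) (C : ℝ)
    (hm : ∀ k, AEStronglyMeasurable (D k) P) (hC : ∀ k, ∀ᵐ x ∂P, |D k x| ≤ C)
    (ho : ∀ i j, i < j → ∫ x, D i x * D j x ∂P = 0) :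
    ∀ᵐ x ∂P, Tendsto (fun n : ℕ => (n : ℝ)⁻¹ * ∑ k ∈ Finset.Icc 1 n, D k x) atTop (𝓝 0) := by
  have hC0 : 0 ≤ C := by
    obtain ⟨x, hx⟩ := (hC 0).exists
    exact (abs_nonneg _).trans hx
  have hij : ∀ i j, Integrable (fun x => D i x * D j x) P := by
    intro i j
    refine Integrable.of_bound ((hm i).mul (hm j)) (C * C) ?_
    filter_upwards [hC i, hC j] with x h1 h2
    rw [Real.norm_eq_abs, abs_mul]
    gcongr
  set s : ℕ → Ω → ℝ := fun n x => ∑ k ∈ Finset.Icc 1 n, D k x with hs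
  have hsq : ∀ n, ∫ x, (s n x) ^ 2 ∂P ≤ n * C ^ 2 := by
    intro n
    have h1 : ∀ x, (s n x) ^ 2 = ∑ i ∈ Finset.Icc 1 n, ∑ j ∈ Finset.Icc 1 n, D i x * D j x := by
      intro x; rw [sq, hs, Finset.sum_mul_sum]
    simp_rw [h1]
    rw [integral_finsetSum _ (fun i _ => integrable_finsetSum _ fun j _ => hij i j)]
    have h2 : ∀ i ∈ Finset.Icc 1 n, ∫ x, ∑ j ∈ Finset.Icc 1 n, D i x * D j x ∂P ≤ C ^ 2 := by
      intro i hi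
      rw [integral_finsetSum _ (fun j _ => hij i j), Finset.sum_eq_single i]
      · calc ∫ x, D i x * D i x ∂P ≤ ∫ x, C ^ 2 ∂P := by
              refine integral_mono_ae (hij i i) (integrable_const _) ?_
              filter_upwards [hC i] with x hx
              nlinarith [abs_mul_abs_self (D i x), abs_nonneg (D i x)]
          _ = C ^ 2 := by simp
      · intro j _ hji
        rcases lt_or_gt_of_ne hji with h | h
        · rw [← ho j i h]; congr 1; ext x; ring
        · exact ho i j h
      · intro h; exact absurd hi h
    refine (Finset.sum_le_sum h2).trans ?_
    simp
  have hsm : ∀ n, AEStronglyMeasurable (s n) P := fun n =>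
    Finset.aestronglyMeasurable_fun_sum _ fun k _ => hm k
  have hall : ∀ᵐ x ∂P, ∀ k, |D k x| ≤ C := ae_all_iff.mpr hC
  have hsb : ∀ n, ∀ᵐ x ∂P, |s n x| ≤ n * C := by
    intro n
    filter_upwards [hall] with x hx
    calc |s n x| ≤ ∑ k ∈ Finset.Icc 1 n, |D k x| := Finset.abs_sum_le_sum_abs _ _
      _ ≤ ∑ k ∈ Finset.Icc 1 n, C := Finset.sum_le_sum fun k _ => hx k
      _ = n * C := by simp
  have hsi : ∀ n, Integrable (fun x => (s n x) ^ 2) P := by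
    intro n
    refine Integrable.of_bound ((hsm n).pow 2) ((n * C) ^ 2) ?_
    filter_upwards [hsb n] with x hx
    rw [Real.norm_eq_abs, abs_pow]
    gcongr
  -- along squares
  have hsum : ∀ᵐ x ∂P, Summable fun m : ℕ => (s (m ^ 2) x / (m : ℝ) ^ 2) ^ 2 := by
    have hfin : ∑' m : ℕ, ∫⁻ x, ENNReal.ofReal ((s (m ^ 2) x / (m : ℝ) ^ 2) ^ 2) ∂P ≠ ⊤ := by
      have hle : ∀ m : ℕ, ∫⁻ x, ENNReal.ofReal ((s (m ^ 2) x / (m : ℝ) ^ 2) ^ 2) ∂P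
          ≤ ENNReal.ofReal (C ^ 2 * (1 / (m : ℝ) ^ 2)) := by
        intro m
        have hi : Integrable (fun x => (s (m ^ 2) x / (m : ℝ) ^ 2) ^ 2) P := by
          simp_rw [div_pow]
          exact (hsi _).div_const _
        rw [← ofReal_integral_eq_lintegral_ofReal hi (ae_of_all _ fun x => sq_nonneg _)]
        refine ENNReal.ofReal_le_ofReal ?_
        simp_rw [div_pow]
        rw [integral_div]
        rcases Nat.eq_zero_or_pos m with h | h
        · subst h; simp
        have h' : (0:ℝ) < m := by exact_mod_cast h
        have := hsq (m ^ 2)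
        push_cast at this
        rw [div_le_iff₀ (by positivity)]
        calc _ ≤ _ := this
          _ = _ := by field_simp
      refine ne_top_of_le_ne_top ?_ (ENNReal.tsum_le_tsum hle)
      have hsm : Summable fun m : ℕ => C ^ 2 * (1 / (m : ℝ) ^ 2) :=
        (Real.summable_one_div_nat_pow.mpr one_lt_two).mul_left _
      rw [← ENNReal.ofReal_tsum_of_nonneg (fun m => by positivity) hsm]
      exact ENNReal.ofReal_ne_top
    have hmeas : ∀ m : ℕ, AEMeasurable (fun x => ENNReal.ofReal ((s (m ^ 2) x / (m : ℝ) ^ 2) ^ 2)) P :=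
      fun m => (((hsm _).aemeasurable.div_const _).pow_const 2).ennreal_ofReal
    rw [← lintegral_tsum hmeas] at hfin
    filter_upwards [ae_lt_top' (AEMeasurable.tsum hmeas) hfin] with x hx
    have := ENNReal.summable_toReal hx.ne
    refine this.congr fun m => ?_
    rw [ENNReal.toReal_ofReal (sq_nonneg _)]
  filter_upwards [hall, hsum] with x hx hsx
  have hz : Tendsto (fun m : ℕ => |s (m ^ 2) x / (m : ℝ) ^ 2|) atTop (𝓝 0) := by
    have h1 := hsx.tendsto_atTop_zero
    have h2 := (Real.continuous_sqrt.tendsto 0).comp h1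
    rw [Real.sqrt_zero] at h2
    refine h2.congr fun m => ?_
    simp [Real.sqrt_sq_eq_abs]
  have hsqrt : Tendsto Nat.sqrt atTop atTop := by
    refine tendsto_atTop.mpr fun b => ?_
    filter_upwards [eventually_ge_atTop (b ^ 2)] with n hn
    rw [Nat.le_sqrt']; exact hn
  have hz2 := (hz.comp hsqrt)
  have hz3 : Tendsto (fun n : ℕ => 2 * C * ((Nat.sqrt n : ℕ) : ℝ)⁻¹) atTop (𝓝 0) := by
    have := (tendsto_inv_atTop_nhds_zero_nat (𝕜 := ℝ)).comp hsqrt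
    simpa using this.const_mul (2 * C)
  refine squeeze_zero_norm' ?_ (by simpa using hz2.add hz3)
  filter_upwards [eventually_gt_atTop 0] with n hn
  set m := Nat.sqrt n with hmdef
  have hm1 : m ^ 2 ≤ n := Nat.sqrt_le' n
  have hm2 : n ≤ m ^ 2 + 2 * m := by
    have := Nat.sqrt_le_add n
    rw [← hmdef] at this; nlinarith
  have hm0 : 0 < m := Nat.sqrt_pos.mpr hn
  have hm0' : (0:ℝ) < m := by exact_mod_cast hm0
  have hn' : (0:ℝ) < n := by exact_mod_cast hn
  have hdiff : |s n x| ≤ |s (m ^ 2) x| + 2 * m * C := by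
    have : s n x = s (m ^ 2) x + ∑ k ∈ Finset.Ioc (m ^ 2) n, D k x := by
      simp only [hs]
      have hI : ∀ n, Finset.Icc 1 n = Finset.Ioc 0 n := fun n => by ext; simp; omega
      rw [hI, hI, Finset.sum_Ioc_consecutive _ (Nat.zero_le _) hm1]
    rw [this]
    refine (abs_add_le _ _).trans ?_
    gcongr
    calc |∑ k ∈ Finset.Ioc (m ^ 2) n, D k x| ≤ ∑ k ∈ Finset.Ioc (m ^ 2) n, |D k x| :=
          Finset.abs_sum_le_sum_abs _ _
      _ ≤ ∑ k ∈ Finset.Ioc (m ^ 2) n, C := Finset.sum_le_sum fun k _ => hx k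
      _ = (n - m ^ 2 : ℕ) * C := by simp
      _ ≤ 2 * m * C := by
        gcongr
        have : n - m ^ 2 ≤ 2 * m := by omega
        exact_mod_cast this
  have hmn : (m:ℝ) ^ 2 ≤ n := by exact_mod_cast hm1
  rw [Real.norm_eq_abs, abs_mul, abs_of_pos (inv_pos.mpr hn'), abs_div,
    abs_of_pos (by positivity : (0:ℝ) < (m:ℝ)^2)]
  calc (n:ℝ)⁻¹ * |s n x| ≤ ((m:ℝ)^2)⁻¹ * (|s (m ^ 2) x| + 2 * m * C) := by gcongr
    _ = _ := by field_simp

lemma integral_comp_mp {P : Measure Ω} {T : Ω → Ω} (hT : MeasurePreserving T P P)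
    {f : Ω → ℝ} (hf : Integrable f P) : ∫ x, f (T x) ∂P = ∫ x, f x ∂P := by
  have := integral_map (μ := P) hT.measurable.aemeasurable (f := f)
    (by rw [hT.map_eq]; exact hf.aestronglyMeasurable)
  rw [hT.map_eq] at this
  exact this.symm

lemma integrable_comp_mp {P : Measure Ω} {T : Ω → Ω} (hT : MeasurePreserving T P P)
    {f : Ω → ℝ} (hf : Integrable f P) : Integrable (fun x => f (T x)) P :=
  hT.integrable_comp_of_integrable hf

lemma ae_comp_mp {P : Measure Ω} {T : Ω → Ω} (hT : MeasurePreserving T P P)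
    {p : Ω → Prop} (hp : ∀ᵐ x ∂P, p x) : ∀ᵐ x ∂P, p (T x) :=
  hT.quasiMeasurePreserving.ae hp

lemma mp_iter {P : Measure Ω} {T : Ω → Ω} (hT : MeasurePreserving T P P) (k : ℕ) :
    MeasurePreserving T^[k] P P := hT.iterate k

lemma ae_all_iterate {P : Measure Ω} {T : Ω → Ω} (hT : MeasurePreserving T P P)
    {p : ℕ → Ω → Prop} (hp : ∀ k, ∀ᵐ x ∂P, p k x) : ∀ᵐ x ∂P, ∀ k, p k (T^[k] x) := by
  rw [ae_all_iff]
  intro k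
  exact ae_comp_mp (mp_iter hT k) (hp k)

lemma abs_condExp_le' (P : Measure Ω) [IsProbabilityMeasure P] (m : MeasurableSpace Ω)
    (F W : Ω → ℝ) (hF : Integrable F P) (hW : Integrable W P) (h : ∀ᵐ x ∂P, |F x| ≤ W x) :
    ∀ᵐ x ∂P, |(P[F | m]) x| ≤ (P[W | m]) x := by
  have h1 := condExp_mono (m := m) hF hW (h.mono fun x hx => (le_abs_self _).trans hx)
  have h2 := condExp_mono (m := m) hW.neg hF (h.mono fun x hx => by
    have := neg_abs_le (F x)
    simp only [Pi.neg_apply]; linarith)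
  filter_upwards [h1, h2, condExp_neg W m (μ := P)] with x a b c
  rw [c] at b
  exact abs_le.mpr ⟨b, a⟩

lemma abs_condExp_sub_le (P : Measure Ω) [IsProbabilityMeasure P] (m : MeasurableSpace Ω)
    (F F' W : Ω → ℝ) (hF : Integrable F P) (hF' : Integrable F' P) (hW : Integrable W P)
    (h : ∀ᵐ x ∂P, |F x - F' x| ≤ W x) :
    ∀ᵐ x ∂P, |(P[F | m]) x - (P[F' | m]) x| ≤ (P[W | m]) x := by
  filter_upwards [abs_condExp_le' P m (F - F') W (hF.sub hF') hW h,
    condExp_sub hF hF' m] with x h1 h2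
  rw [h2] at h1
  exact h1

lemma int_mul_condExp (P : Measure Ω) [IsProbabilityMeasure P] (m : MeasurableSpace Ω)
    (hm : m ≤ m0) (e F : Ω → ℝ) (he : StronglyMeasurable[m] e) (C : ℝ)
    (hC : ∀ᵐ x ∂P, |e x| ≤ C) (hF : Integrable F P) :
    ∫ x, e x * (P[F | m]) x ∂P = ∫ x, e x * F x ∂P := by
  have hi : Integrable (e * F) P := hF.bdd_mul (he.mono hm).aestronglyMeasurable hC
  have := condExp_mul_of_stronglyMeasurable_left he hi hF
  have h2 := integral_congr_ae this
  rw [integral_condExp hm] at h2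
  exact h2.symm

lemma mart_bdd (P : Measure Ω) [IsProbabilityMeasure P] (T S : Ω → Ω)
    (hT : MeasurePreserving T P P) (hS : MeasurePreserving S P P)
    (hST : Function.LeftInverse S T) (hTS : Function.RightInverse S T)
    (m₁ m₂ : MeasurableSpace Ω) (h12 : m₁ ≤ m₂) (h2 : m₂ ≤ m0)
    (h21 : m₂ ≤ MeasurableSpace.comap T m₁) (F : ℕ → Ω → ℝ) (C : ℝ)
    (hF : ∀ k, Integrable (F k) P) (hC : ∀ k, ∀ᵐ x ∂P, |F k x| ≤ C) :
    ∀ᵐ x ∂P, Tendsto (fun n : ℕ => (n : ℝ)⁻¹ * ∑ k ∈ Finset.Icc 1 n,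
      ((P[F k | m₂]) (T^[k] x) - (P[F k | m₁]) (T^[k] x))) atTop (𝓝 0) := by
  have h1 : m₁ ≤ m0 := h12.trans h2
  set d : ℕ → Ω → ℝ := fun k x => (P[F k | m₂]) x - (P[F k | m₁]) x with hd
  have hdm : ∀ k, StronglyMeasurable[m₂] (d k) := fun k =>
    stronglyMeasurable_condExp.sub (stronglyMeasurable_condExp.mono h12)
  have hdi : ∀ k, Integrable (d k) P := fun k => integrable_condExp.sub integrable_condExp
  have hdb : ∀ k, ∀ᵐ x ∂P, |d k x| ≤ 2 * C := by
    intro k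
    filter_upwards [ae_bdd_abs_condExp_of_ae_bdd_abs (m := m₂) (hC k),
      ae_bdd_abs_condExp_of_ae_bdd_abs (m := m₁) (hC k)] with x a b
    have := abs_sub (P[F k | m₂] x) (P[F k | m₁] x)
    simp only [hd]; linarith
  have hmn : ∀ n : ℕ, m₂ ≤ MeasurableSpace.comap (T^[n + 1]) m₁ := by
    intro n
    induction n with
    | zero => simpa using h21
    | succ n ih =>
      calc m₂ ≤ MeasurableSpace.comap T m₁ := h21
        _ ≤ MeasurableSpace.comap T m₂ := MeasurableSpace.comap_mono h12
        _ ≤ MeasurableSpace.comap T (MeasurableSpace.comap (T^[n + 1]) m₁) :=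
          MeasurableSpace.comap_mono ih
        _ = _ := by rw [MeasurableSpace.comap_comp, ← Function.iterate_succ]
  have main := slln_orth P (fun k x => d k (T^[k] x)) (2 * C)
    (fun k => (integrable_comp_mp (mp_iter hT k) (hdi k)).aestronglyMeasurable)
    (fun k => ae_comp_mp (mp_iter hT k) (hdb k)) ?_
  · exact main
  intro i j hij
  obtain ⟨n, rfl⟩ : ∃ n, j = i + (n + 1) := ⟨j - i - 1, by omega⟩
  set e : Ω → ℝ := fun x => d i (S^[n + 1] x) with he
  have hTSn : Function.LeftInverse (T^[n + 1]) (S^[n + 1]) := Function.LeftInverse.iterate hTS _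
  have hSTn : Function.LeftInverse (S^[n + 1]) (T^[n + 1]) := Function.LeftInverse.iterate hST _
  have hem : StronglyMeasurable[m₁] e := by
    suffices hh : Measurable[m₁] e from hh.stronglyMeasurable
    intro B hB
    have hB' : MeasurableSet[m₂] (d i ⁻¹' B) := (hdm i).measurable hB
    obtain ⟨A, hA, hAB⟩ := hmn n _ hB'
    have : e ⁻¹' B = A := by
      ext x
      have h3 : S^[n + 1] x ∈ T^[n + 1] ⁻¹' A ↔ S^[n + 1] x ∈ d i ⁻¹' B := by rw [hAB]
      simp only [mem_preimage, hTSn x] at h3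
      exact h3.symm
    rw [this]; exact hA
  have heb : ∀ᵐ x ∂P, |e x| ≤ 2 * C := ae_comp_mp (mp_iter hS (n + 1)) (hdb i)
  have hed : Integrable (fun x => e x * d (i + (n + 1)) x) P :=
    (hdi _).bdd_mul (hem.mono h1).aestronglyMeasurable heb
  have h5 : ∀ x, d i (T^[i] x) * d (i + (n + 1)) (T^[i + (n + 1)] x)
      = (fun y => e y * d (i + (n + 1)) y) (T^[i + (n + 1)] x) := by
    intro x
    simp only [he]
    congr 2
    rw [add_comm i, Function.iterate_add_apply T (n + 1) i, hSTn]
  simp_rw [h5]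
  rw [integral_comp_mp (mp_iter hT _) hed]
  have e1 := int_mul_condExp P m₁ h1 e (F (i + (n + 1))) hem _ heb (hF _)
  have e2 := int_mul_condExp P m₂ h2 e (F (i + (n + 1))) (hem.mono h12) _ heb (hF _)
  have i1 : Integrable (fun x => e x * (P[F (i + (n + 1)) | m₁]) x) P :=
    integrable_condExp.bdd_mul (hem.mono h1).aestronglyMeasurable heb
  have i2 : Integrable (fun x => e x * (P[F (i + (n + 1)) | m₂]) x) P :=
    integrable_condExp.bdd_mul (hem.mono h1).aestronglyMeasurable heb
  simp only [hd, mul_sub]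
  rw [integral_sub i2 i1, e1, e2, sub_self]

lemma avg_abs_le (n : ℕ) (a b c : ℕ → ℝ) (h : ∀ k, |a k - c k| ≤ b k) :
    |(n : ℝ)⁻¹ * ∑ k ∈ Finset.Icc 1 n, a k| ≤
      (n : ℝ)⁻¹ * ∑ k ∈ Finset.Icc 1 n, b k + |(n : ℝ)⁻¹ * ∑ k ∈ Finset.Icc 1 n, c k| := by
  have h0 : (0 : ℝ) ≤ (n : ℝ)⁻¹ := by positivity
  have h1 : |∑ k ∈ Finset.Icc 1 n, a k - ∑ k ∈ Finset.Icc 1 n, c k|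
      ≤ ∑ k ∈ Finset.Icc 1 n, b k := by
    rw [← Finset.sum_sub_distrib]
    exact (Finset.abs_sum_le_sum_abs _ _).trans (Finset.sum_le_sum fun k _ => h k)
  rw [abs_mul, abs_mul, abs_of_nonneg h0, ← mul_add]
  gcongr
  have := abs_sub_abs_le_abs_sub (∑ k ∈ Finset.Icc 1 n, a k) (∑ k ∈ Finset.Icc 1 n, c k)
  linarith

lemma trunc_small (P : Measure Ω) (Λ : Ω → ℝ) (hΛ : Integrable Λ P) :
    Tendsto (fun M : ℕ => ∫ x, max (Λ x - M) 0 ∂P) atTop (𝓝 0) := by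
  have : Tendsto (fun M : ℕ => ∫ x, max (Λ x - M) 0 ∂P) atTop (𝓝 (∫ x, (0:ℝ) ∂P)) := by
    refine tendsto_integral_of_dominated_convergence (fun x => |Λ x|) (fun M => ?_) hΛ.abs
      (fun M => ae_of_all _ fun x => ?_) (ae_of_all _ fun x => ?_)
    · exact (hΛ.aestronglyMeasurable.sub aestronglyMeasurable_const).sup aestronglyMeasurable_const
    · rw [Real.norm_eq_abs, abs_of_nonneg (le_max_right _ _)]
      refine max_le ?_ (abs_nonneg _)
      have := le_abs_self (Λ x)
      have : (0:ℝ) ≤ M := Nat.cast_nonneg M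
      linarith
    · refine tendsto_const_nhds.congr' ?_
      obtain ⟨N, hN⟩ := exists_nat_gt (Λ x)
      filter_upwards [eventually_ge_atTop N] with M hM
      have : (N:ℝ) ≤ M := by exact_mod_cast hM
      rw [max_eq_right]; linarith
  simpa using this

lemma mart_conv (P : Measure Ω) [IsProbabilityMeasure P] (T S : Ω → Ω)
    (hT : Ergodic T P) (hS : MeasurePreserving S P P)
    (hST : Function.LeftInverse S T) (hTS : Function.RightInverse S T)
    (Λ : Ω → ℝ) (hΛ : Integrable Λ P)
    (F : ℕ → Ω → ℝ) (hF : ∀ k, Integrable (F k) P) (hFΛ : ∀ k x, |F k x| ≤ Λ x)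
    (m₁ m₂ : MeasurableSpace Ω) (h12 : m₁ ≤ m₂) (h2 : m₂ ≤ m0)
    (h21 : m₂ ≤ MeasurableSpace.comap T m₁) :
    ∀ᵐ x ∂P, Tendsto (fun n : ℕ => (n : ℝ)⁻¹ * ∑ k ∈ Finset.Icc 1 n,
      ((P[F k | m₂]) (T^[k] x) - (P[F k | m₁]) (T^[k] x))) atTop (𝓝 0) := by
  refine tendsto_of_eps P _ fun ε hε => ?_
  have hT' := hT.toMeasurePreserving
  obtain ⟨M, hM⟩ := ((trunc_small P Λ hΛ).eventually
    (gt_mem_nhds (show (0:ℝ) < ε / 8 by linarith))).exists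
  set W : Ω → ℝ := fun x => max (Λ x - M) 0 with hW
  have hWi : Integrable W P := (hΛ.sub (integrable_const _)).sup (integrable_const _)
  set FM : ℕ → Ω → ℝ := fun k x => max (-(M:ℝ)) (min (M:ℝ) (F k x)) with hFM
  have hFMi : ∀ k, Integrable (FM k) P := fun k =>
    (integrable_const (-(M:ℝ))).sup ((integrable_const (M:ℝ)).inf (hF k))
  have hM0 : (0:ℝ) ≤ M := Nat.cast_nonneg M
  have hFMb : ∀ k x, |FM k x| ≤ M := by
    intro k x
    rw [abs_le]
    exact ⟨le_max_left _ _, max_le (by linarith) (min_le_left _ _)⟩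
  have hdiff : ∀ k x, |F k x - FM k x| ≤ W x := by
    intro k x
    have h1 := abs_le.mp (hFΛ k x)
    have h3 := le_max_left (Λ x - M) 0
    have h4 := le_max_right (Λ x - M) 0
    rw [abs_le]
    simp only [hFM, hW]
    rcases max_cases (-(M:ℝ)) (min (M:ℝ) (F k x)) with a | a <;>
    rcases min_cases (M:ℝ) (F k x) with b | b <;> constructor <;> linarith [h1.1, h1.2]
  set R : Ω → ℝ := fun x => (P[W | m₂]) x + (P[W | m₁]) x with hR
  have hRi : Integrable R P := integrable_condExp.add integrable_condExp
  have hRint : ∫ x, R x ∂P < ε / 2 := by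
    simp only [hR]
    rw [integral_add integrable_condExp integrable_condExp, integral_condExp h2,
      integral_condExp (h12.trans h2)]
    linarith
  have hall := ae_all_iterate hT' (fun k => abs_condExp_sub_le P m₂ (F k) (FM k) W (hF k) (hFMi k)
    hWi (ae_of_all _ (hdiff k)))
  have hall' := ae_all_iterate hT' (fun k => abs_condExp_sub_le P m₁ (F k) (FM k) W (hF k) (hFMi k)
    hWi (ae_of_all _ (hdiff k)))
  filter_upwards [hall, hall', birk_upper P T hT R hRi _ hRint,
    mart_bdd P T S hT' hS hST hTS m₁ m₂ h12 h2 h21 FM M hFMi (fun k => ae_of_all _ (hFMb k))]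
    with x a1 a2 a3 a4
  have a5 := a4.abs
  rw [abs_zero] at a5
  filter_upwards [a3, a5.eventually (gt_mem_nhds (show (0:ℝ) < ε / 2 by linarith))] with n b1 b2
  refine (avg_abs_le n _ (fun k => R (T^[k] x)) _ ?_).trans
    (by linarith : _ + |(n : ℝ)⁻¹ * ∑ k ∈ Finset.Icc 1 n,
      ((P[FM k | m₂]) (T^[k] x) - (P[FM k | m₁]) (T^[k] x))| ≤ ε)
  intro k
  have c1 := abs_le.mp (a1 k)
  have c2 := abs_le.mp (a2 k)
  rw [abs_le]
  simp only [hR]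
  constructor <;> linarith [c1.1, c1.2, c2.1, c2.2]

lemma mart_chain (P : Measure Ω) [IsProbabilityMeasure P] (T S : Ω → Ω)
    (hT : Ergodic T P) (hS : MeasurePreserving S P P)
    (hST : Function.LeftInverse S T) (hTS : Function.RightInverse S T)
    (Λ : Ω → ℝ) (hΛ : Integrable Λ P)
    (F : ℕ → Ω → ℝ) (hF : ∀ k, Integrable (F k) P) (hFΛ : ∀ k x, |F k x| ≤ Λ x)
    (G : ℕ → MeasurableSpace Ω) (h12 : ∀ i, G i ≤ G (i + 1)) (h2 : ∀ i, G i ≤ m0)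
    (h21 : ∀ i, G (i + 1) ≤ MeasurableSpace.comap T (G i)) (N : ℕ) :
    ∀ᵐ x ∂P, Tendsto (fun n : ℕ => (n : ℝ)⁻¹ * ∑ k ∈ Finset.Icc 1 n,
      ((P[F k | G N]) (T^[k] x) - (P[F k | G 0]) (T^[k] x))) atTop (𝓝 0) := by
  induction N with
  | zero => simp
  | succ N ih =>
    filter_upwards [ih, mart_conv P T S hT hS hST hTS Λ hΛ F hF hFΛ (G N) (G (N + 1)) (h12 N)
      (h2 _) (h21 N)] with x h1 h2
    have h3 := h1.add h2
    rw [add_zero] at h3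
    refine h3.congr fun n => ?_
    rw [← mul_add, ← Finset.sum_add_distrib]
    congr 1
    refine Finset.sum_congr rfl fun k _ => ?_
    ring


lemma mp_meas {P : Measure Ω} {T : Ω → Ω} (hT : MeasurePreserving T P P) : Measurable T :=
  hT.measurable

lemma lint_tsum_le (P : Measure Ω) (a : ℕ → Ω → ℝ) (ha : ∀ j, Integrable (a j) P)
    (h0 : ∀ j, ∀ᵐ x ∂P, 0 ≤ a j x) (hb : ∀ j, ∫ x, a j x ∂P ≤ (1 / 2 : ℝ) ^ j) (J : ℕ) :
    ∫⁻ x, ∑' j, ENNReal.ofReal (a (j + J) x) ∂P ≤ ENNReal.ofReal ((1 / 2 : ℝ) ^ J * 2) := by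
  rw [lintegral_tsum fun j => (ha _).aestronglyMeasurable.aemeasurable.ennreal_ofReal]
  have hle : ∀ j, ∫⁻ x, ENNReal.ofReal (a (j + J) x) ∂P
      ≤ ENNReal.ofReal ((1 / 2 : ℝ) ^ J * (1 / 2 : ℝ) ^ j) := by
    intro j
    rw [← ofReal_integral_eq_lintegral_ofReal (ha _) (h0 _)]
    refine ENNReal.ofReal_le_ofReal ((hb _).trans (le_of_eq ?_))
    rw [pow_add, mul_comm]
  refine (ENNReal.tsum_le_tsum hle).trans (le_of_eq ?_)
  have hs : Summable fun j : ℕ => (1 / 2 : ℝ) ^ J * (1 / 2 : ℝ) ^ j :=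
    (summable_geometric_two).mul_left _
  rw [← ENNReal.ofReal_tsum_of_nonneg (fun j => by positivity) hs, tsum_mul_left,
    tsum_geometric_two]

lemma envelope (P : Measure Ω) (a : ℕ → Ω → ℝ) (ha : ∀ j, Integrable (a j) P)
    (h0 : ∀ j, ∀ᵐ x ∂P, 0 ≤ a j x) (hb : ∀ j, ∫ x, a j x ∂P ≤ (1 / 2 : ℝ) ^ j)
    (ε : ℝ) (hε : 0 < ε) :
    ∃ (J : ℕ) (H : Ω → ℝ), Integrable H P ∧ ∫ x, H x ∂P < ε ∧
      ∀ᵐ x ∂P, ∀ j, J ≤ j → a j x ≤ H x := by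
  obtain ⟨J, hJ⟩ := exists_pow_lt_of_lt_one (show (0:ℝ) < ε / 2 by linarith)
    (show (1 / 2 : ℝ) < 1 by norm_num)
  have hl := lint_tsum_le P a ha h0 hb J
  have hm : AEMeasurable (fun x => ∑' j, ENNReal.ofReal (a (j + J) x)) P :=
    AEMeasurable.tsum fun j => (ha _).aestronglyMeasurable.aemeasurable.ennreal_ofReal
  have hne : ∫⁻ x, ∑' j, ENNReal.ofReal (a (j + J) x) ∂P ≠ ⊤ :=
    ne_top_of_le_ne_top ENNReal.ofReal_ne_top hl
  have hfin := ae_lt_top' hm hne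
  refine ⟨J, fun x => (∑' j, ENNReal.ofReal (a (j + J) x)).toReal,
    integrable_toReal_of_lintegral_ne_top hm hne, ?_, ?_⟩
  · rw [integral_toReal hm hfin]
    refine (ENNReal.toReal_le_of_le_ofReal (by positivity) hl).trans_lt ?_
    linarith
  · filter_upwards [hfin] with x hx j hj
    obtain ⟨i, rfl⟩ : ∃ i, j = i + J := ⟨j - J, by omega⟩
    have h1 : ENNReal.ofReal (a (i + J) x) ≤ ∑' j, ENNReal.ofReal (a (j + J) x) :=
      ENNReal.le_tsum i
    exact (ENNReal.ofReal_le_iff_le_toReal hx.ne).mp h1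

lemma ae_tendsto_zero_of_sum (P : Measure Ω) (a : ℕ → Ω → ℝ) (ha : ∀ j, Integrable (a j) P)
    (h0 : ∀ j, ∀ᵐ x ∂P, 0 ≤ a j x) (hb : ∀ j, ∫ x, a j x ∂P ≤ (1 / 2 : ℝ) ^ j) :
    ∀ᵐ x ∂P, Tendsto (fun j => a j x) atTop (𝓝 0) := by
  have hl := lint_tsum_le P a ha h0 hb 0
  have hm : AEMeasurable (fun x => ∑' j, ENNReal.ofReal (a (j + 0) x)) P :=
    AEMeasurable.tsum fun j => (ha _).aestronglyMeasurable.aemeasurable.ennreal_ofReal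
  have hne : ∫⁻ x, ∑' j, ENNReal.ofReal (a (j + 0) x) ∂P ≠ ⊤ :=
    ne_top_of_le_ne_top ENNReal.ofReal_ne_top hl
  filter_upwards [ae_lt_top' hm hne, ae_all_iff.mpr h0] with x hx hx0
  have h1 := ENNReal.tendsto_atTop_zero_of_tsum_ne_top hx.ne
  have h2 := (ENNReal.tendsto_toReal ENNReal.zero_ne_top).comp h1
  refine h2.congr fun j => ?_
  simp [ENNReal.toReal_ofReal (hx0 j)]

lemma essSup_integrable {ι : Type*} (P : Measure Ω) (S₀ : Set ι) (hne : S₀.Nonempty)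
    (f : ι → Ω → ℝ) (g B : Ω → ℝ) (h : IsEssSupFam P S₀ f g) (hB : Integrable B P)
    (hf : ∀ i ∈ S₀, ∀ᵐ x ∂P, 0 ≤ f i x ∧ f i x ≤ B x) : Integrable g P := by
  obtain ⟨hg, hup, hleast⟩ := h
  obtain ⟨B', hB'm, hBB'⟩ := hB.aestronglyMeasurable
  have h1 := hleast B' hB'm.measurable (fun i hi => by
    filter_upwards [hf i hi, hBB'] with x hx hx'
    rw [← hx']; exact hx.2)
  obtain ⟨i, hi⟩ := hne
  refine hB.mono' hg.aestronglyMeasurable ?_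
  filter_upwards [h1, hBB', hf i hi, hup i hi] with x a b c d
  rw [Real.norm_eq_abs, abs_of_nonneg (c.1.trans d), b]
  exact a

lemma essInf_integrable {ι : Type*} (P : Measure Ω) (S₀ : Set ι) (hne : S₀.Nonempty)
    (f : ι → Ω → ℝ) (g B : Ω → ℝ) (h : IsEssInfFam P S₀ f g) (hB : Integrable B P)
    (hf : ∀ i ∈ S₀, ∀ᵐ x ∂P, |f i x| ≤ B x) : Integrable g P := by
  obtain ⟨hg, hlow, hgr⟩ := h
  obtain ⟨B', hB'm, hBB'⟩ := hB.aestronglyMeasurable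
  have h1 := hgr (fun x => - B' x) hB'm.measurable.neg (fun i hi => by
    filter_upwards [hf i hi, hBB'] with x hx hx'
    rw [← hx']; exact (abs_le.mp hx).1)
  obtain ⟨i, hi⟩ := hne
  refine hB.mono' hg.aestronglyMeasurable ?_
  filter_upwards [h1, hBB', hf i hi, hlow i hi] with x a b c d
  rw [Real.norm_eq_abs, abs_le, b]
  rw [b] at c
  exact ⟨a, d.trans (abs_le.mp c).2⟩

lemma iter_comp_T {T S : Ω → Ω} (hST : Function.LeftInverse S T) (j : ℤ) :
    iter T S j ∘ T = iter T S (j + 1) := by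
  rcases j with n | n
  · rfl
  · rcases n with _ | n
    · funext x
      exact hST x
    · funext x
      change S^[n + 1] (S (T x)) = S^[n + 1] x
      rw [hST]

lemma T_comp_iter {T S : Ω → Ω} (hTS : Function.RightInverse S T) (j : ℤ) :
    T ∘ iter T S j = iter T S (j + 1) := by
  rcases j with n | n
  · exact (Function.iterate_succ' T n).symm
  · rcases n with _ | n
    · funext x
      exact hTS x
    · funext x
      change T (S^[n + 2] x) = S^[n + 1] x
      rw [Function.iterate_succ_apply', hTS]

lemma iter_comp_T_iterate {T S : Ω → Ω} (hST : Function.LeftInverse S T) (j : ℤ) (k : ℕ) :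
    iter T S j ∘ T^[k] = iter T S (j + k) := by
  induction k generalizing j with
  | zero => simp
  | succ k ih =>
    rw [Function.iterate_succ', ← Function.comp_assoc, iter_comp_T hST, ih]
    congr 1; push_cast; ring

lemma iter_comp_S_iterate {T S : Ω → Ω} (hST : Function.LeftInverse S T)
    (hTS : Function.RightInverse S T) (j : ℤ) (k : ℕ) :
    iter T S j ∘ S^[k] = iter T S (j - k) := by
  have h := iter_comp_T_iterate (S := S) hST (j - k) k
  rw [sub_add_cancel] at h
  rw [← h]
  funext x
  have : T^[k] (S^[k] x) = x := (Function.LeftInverse.iterate hTS k) x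
  simp [this]

lemma iter_neg_nat (T S : Ω → Ω) (n : ℕ) : iter T S (-(n : ℤ)) = S^[n] := by
  rcases n with _ | n
  · rfl
  · rfl

lemma iter_nat (T S : Ω → Ω) (n : ℕ) : iter T S (n : ℤ) = T^[n] := rfl

lemma measurable_iter {T S : Ω → Ω} (hT : Measurable[m0] T) (hS : Measurable[m0] S) (j : ℤ) :
    Measurable[m0] (iter T S j) := by
  rcases j with n | n
  · exact hT.iterate n
  · exact hS.iterate (n + 1)

lemma comap_iter_le {T S : Ω → Ω} (hT : Measurable[m0] T) (hS : Measurable[m0] S) (j : ℤ)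
    (Z : MeasurableSpace Ω) (hZ : Z ≤ m0) : MeasurableSpace.comap (iter T S j) Z ≤ m0 :=
  (MeasurableSpace.comap_mono hZ).trans (measurable_iter hT hS j).comap_le

lemma obsFieldLE_le {T S : Ω → Ω} (hT : Measurable[m0] T) (hS : Measurable[m0] S)
    (Y : MeasurableSpace Ω) (hY : Y ≤ m0) (n : ℤ) : obsFieldLE T S Y n ≤ m0 :=
  iSup₂_le fun k _ => comap_iter_le hT hS k Y hY

lemma obsField_le {T S : Ω → Ω} (hT : Measurable[m0] T) (hS : Measurable[m0] S)
    (Y : MeasurableSpace Ω) (hY : Y ≤ m0) (m n : ℤ) : obsField T S Y m n ≤ m0 :=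
  iSup₂_le fun k _ => comap_iter_le hT hS k Y hY

lemma obsField_mono (T S : Ω → Ω) (Y : MeasurableSpace Ω) {m m' : ℤ} (n : ℤ) (h : m' ≤ m) :
    obsField T S Y m n ≤ obsField T S Y m' n :=
  iSup₂_le fun k hk => le_iSup₂_of_le k ⟨h.trans hk.1, hk.2⟩ le_rfl

lemma iSup_obsField (T S : Ω → Ω) (Y : MeasurableSpace Ω) :
    ⨆ m : ℕ, obsField T S Y (-(m : ℤ)) 0 = obsFieldLE T S Y 0 := by
  apply le_antisymm
  · exact iSup_le fun m => iSup₂_le fun k hk => le_iSup₂_of_le k hk.2 le_rfl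
  · refine iSup₂_le fun k hk => ?_
    have hk' : k ≤ 0 := hk
    exact le_iSup_of_le (-k).toNat (le_iSup₂_of_le k ⟨by omega, hk'⟩ le_rfl)

/-- The σ-fields `𝒴_{-∞,0} ∨ T^{-j}𝒳`. -/
def Gf (T S : Ω → Ω) (Y X : MeasurableSpace Ω) (j : ℤ) : MeasurableSpace Ω :=
  obsFieldLE T S Y 0 ⊔ MeasurableSpace.comap (iter T S j) X

lemma Gf_le {T S : Ω → Ω} (hT : Measurable[m0] T) (hS : Measurable[m0] S)
    (Y X : MeasurableSpace Ω) (hY : Y ≤ m0) (hX : X ≤ m0) (j : ℤ) : Gf T S Y X j ≤ m0 :=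
  sup_le (obsFieldLE_le hT hS Y hY 0) (comap_iter_le hT hS j X hX)

lemma Gf_mono {T S : Ω → Ω} (hTS : Function.RightInverse S T)
    (Y X : MeasurableSpace Ω) (hX1 : X ≤ MeasurableSpace.comap T X) (j : ℤ) :
    Gf T S Y X j ≤ Gf T S Y X (j + 1) := by
  refine sup_le_sup le_rfl ?_
  refine (MeasurableSpace.comap_mono hX1).trans ?_
  rw [MeasurableSpace.comap_comp, T_comp_iter hTS]

lemma Gf_shift {T S : Ω → Ω} (hST : Function.LeftInverse S T)
    (Y X : MeasurableSpace Ω) (j : ℤ) :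
    Gf T S Y X (j + 1) ≤ MeasurableSpace.comap T (Gf T S Y X j) := by
  refine sup_le ?_ ?_
  · refine le_trans ?_ (MeasurableSpace.comap_mono (le_sup_left : _ ≤ Gf T S Y X j))
    refine iSup₂_le fun k hk => ?_
    have hk' : k ≤ 0 := hk
    have h1 : MeasurableSpace.comap (iter T S (k - 1)) Y ≤ obsFieldLE T S Y 0 :=
      le_iSup₂_of_le (k - 1) (show k - 1 ≤ 0 by omega) le_rfl
    refine le_trans ?_ (MeasurableSpace.comap_mono h1)
    rw [MeasurableSpace.comap_comp, iter_comp_T hST, sub_add_cancel]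
  · refine le_trans ?_ (MeasurableSpace.comap_mono (le_sup_right : _ ≤ Gf T S Y X j))
    rw [MeasurableSpace.comap_comp, iter_comp_T hST]

lemma tailField_le {T S : Ω → Ω} (hT : Measurable[m0] T) (hS : Measurable[m0] S)
    (Y X : MeasurableSpace Ω) (hY : Y ≤ m0) (hX : X ≤ m0) : tailField T S Y X ≤ m0 := by
  refine iInf_le_of_le 0 ?_
  have := Gf_le hT hS Y X hY hX (-((1 : ℕ) : ℤ))
  rwa [Gf, iter_neg_nat] at this

lemma Un_measurable {T S : Ω → Ω} (hT : Measurable[m0] T) (hS : Measurable[m0] S)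
    (Y : MeasurableSpace Ω) (hY : Y ≤ m0) (v : Ω → U) (hv : v ∈ (Un T S Y 0 : Set (Ω → U))) :
    Measurable[m0] v := by
  simp only [Un, mem_iUnion] at hv
  obtain ⟨m, _, hm⟩ := hv
  have hm' : Measurable[obsField T S Y m 0] v := hm
  exact hm'.mono (obsField_le hT hS Y hY m 0) le_rfl

lemma Un_nat {T S : Ω → Ω} (Y : MeasurableSpace Ω) (v : Ω → U)
    (hv : v ∈ (Un T S Y 0 : Set (Ω → U))) :
    ∃ m : ℕ, Measurable[obsField T S Y (-(m : ℤ)) 0] v := by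
  simp only [Un, mem_iUnion] at hv
  obtain ⟨m, hm0, hm⟩ := hv
  have hm' : Measurable[obsField T S Y m 0] v := hm
  refine ⟨(-m).toNat, hm'.mono (obsField_mono T S Y 0 (by omega)) le_rfl⟩

lemma mem_Un {T S : Ω → Ω} (Y : MeasurableSpace Ω) (v : Ω → U) (m : ℕ)
    (hv : Measurable[obsField T S Y (-(m : ℤ)) 0] v) : v ∈ (Un T S Y 0 : Set (Ω → U)) := by
  simp only [Un, mem_iUnion]
  exact ⟨-(m : ℤ), by simp, hv⟩

lemma const_mem_Un (T S : Ω → Ω) (Y : MeasurableSpace Ω) (u : U) :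
    (fun _ => u) ∈ (Un T S Y 0 : Set (Ω → U)) :=
  mem_Un Y _ 0 measurable_const

lemma loss_integrable {P : Measure Ω} {T S : Ω → Ω} (ℓ : U → Ω → ℝ)
    (hℓ : Measurable fun p : U × Ω => ℓ p.1 p.2)
    (Λ : Ω → ℝ) (hΛ : Integrable Λ P) (hdom : ∀ u ω, |ℓ u ω| ≤ Λ ω)
    (v : Ω → U) (hv : Measurable[m0] v) : Integrable (lossAt T S ℓ 0 v) P := by
  have hm : Measurable[m0] (lossAt T S ℓ 0 v) := hℓ.comp (hv.prodMk measurable_id)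
  exact hΛ.mono' hm.aestronglyMeasurable (ae_of_all _ fun x => hdom _ _)

/-- The key approximation: losses may be replaced by tail conditional expectations. -/
lemma key [Nonempty U] (P : Measure Ω) [IsProbabilityMeasure P]
    (T S : Ω → Ω) (hT : Ergodic T P) (hS : MeasurePreserving S P P)
    (hST : Function.LeftInverse S T) (hTS : Function.RightInverse S T)
    (ℓ : U → Ω → ℝ) (hℓ : Measurable fun p : U × Ω => ℓ p.1 p.2)
    (Λ : Ω → ℝ) (hΛ : Integrable Λ P) (hdom : ∀ u ω, |ℓ u ω| ≤ Λ ω)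
    (Y : MeasurableSpace Ω) (hY : Y ≤ m0)
    (X : MeasurableSpace Ω) (hX : X ≤ m0) (hX1 : X ≤ MeasurableSpace.comap T X)
    (g₁ : ℕ → Ω → ℝ)
    (hg₁ : ∀ n : ℕ, IsEssSupFam P (Un T S Y 0 : Set (Ω → U))
      (fun v ω =>
        |(P[lossAt T S ℓ 0 v | obsFieldLE T S Y 0 ⊔ MeasurableSpace.comap (T^[n]) X]) ω -
          lossAt T S ℓ 0 v ω|) (g₁ n))
    (hg₁0 : Tendsto (fun n : ℕ => ∫ ω, |g₁ n ω| ∂P) atTop (𝓝 0))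
    (g₂ : ℕ → Ω → ℝ)
    (hg₂ : ∀ n : ℕ, IsEssSupFam P (Un T S Y 0 : Set (Ω → U))
      (fun v ω =>
        |(P[lossAt T S ℓ 0 v | obsFieldLE T S Y 0 ⊔ MeasurableSpace.comap (S^[n]) X]) ω -
          (P[lossAt T S ℓ 0 v | tailField T S Y X]) ω|) (g₂ n))
    (hg₂0 : Tendsto (fun n : ℕ => ∫ ω, |g₂ n ω| ∂P) atTop (𝓝 0))
    (v : ℕ → Ω → U) (hv : ∀ k, v k ∈ (Un T S Y 0 : Set (Ω → U))) :
    ∀ᵐ x ∂P, Tendsto (fun n : ℕ => (n : ℝ)⁻¹ * ∑ k ∈ Finset.Icc 1 n,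
      (lossAt T S ℓ 0 (v k) (T^[k] x) - (P[lossAt T S ℓ 0 (v k) | tailField T S Y X]) (T^[k] x)))
      atTop (𝓝 0) := by
  have hT' := hT.toMeasurePreserving
  have hTm := mp_meas hT'
  have hSm := mp_meas hS
  obtain ⟨u0⟩ := ‹Nonempty U›
  have hne : (Un T S Y 0 : Set (Ω → U)).Nonempty := ⟨_, const_mem_Un T S Y u0⟩
  have hli : ∀ w ∈ (Un T S Y 0 : Set (Ω → U)), Integrable (lossAt T S ℓ 0 w) P := fun w hw =>
    loss_integrable ℓ hℓ Λ hΛ hdom w (Un_measurable hTm hSm Y hY w hw)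
  have hlb : ∀ (w : Ω → U) x, |lossAt T S ℓ 0 w x| ≤ Λ x := fun w x => hdom _ _
  have hcb : ∀ (m : MeasurableSpace Ω), ∀ w ∈ (Un T S Y 0 : Set (Ω → U)),
      ∀ᵐ x ∂P, |(P[lossAt T S ℓ 0 w | m]) x| ≤ (P[Λ | m]) x := fun m w hw =>
    abs_condExp_le' P m _ Λ (hli w hw) hΛ (ae_of_all _ (hlb w))
  have hi₁ : ∀ n, Integrable (g₁ n) P := fun n =>
    essSup_integrable P _ hne _ (g₁ n) (fun x => (P[Λ | obsFieldLE T S Y 0 ⊔ MeasurableSpace.comap (T^[n]) X]) x + Λ x) (hg₁ n) (integrable_condExp.add hΛ)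
      (fun w hw => by
        filter_upwards [hcb (obsFieldLE T S Y 0 ⊔ MeasurableSpace.comap (T^[n]) X) w hw] with x hx
        exact ⟨abs_nonneg _, (abs_sub _ _).trans (add_le_add hx (hlb w x))⟩)
  have hi₂ : ∀ n, Integrable (g₂ n) P := fun n =>
    essSup_integrable P _ hne _ (g₂ n) (fun x => (P[Λ | obsFieldLE T S Y 0 ⊔ MeasurableSpace.comap (S^[n]) X]) x + (P[Λ | tailField T S Y X]) x) (hg₂ n) (integrable_condExp.add integrable_condExp)
      (fun w hw => by
        filter_upwards [hcb (obsFieldLE T S Y 0 ⊔ MeasurableSpace.comap (S^[n]) X) w hw,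
          hcb (tailField T S Y X) w hw] with x hx hx'
        exact ⟨abs_nonneg _, (abs_sub _ _).trans (add_le_add hx hx')⟩)
  refine tendsto_of_eps P _ fun ε hε => ?_
  obtain ⟨N, hN1, hN2⟩ := ((hg₁0.eventually (gt_mem_nhds (show (0:ℝ) < ε / 4 by linarith))).and
    (hg₂0.eventually (gt_mem_nhds (show (0:ℝ) < ε / 4 by linarith)))).exists
  have hchain := mart_chain P T S hT hS hST hTS Λ hΛ (fun k => lossAt T S ℓ 0 (v k))
    (fun k => hli _ (hv k)) (fun k => hlb (v k)) (fun i => Gf T S Y X ((i : ℤ) - N))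
    (fun i => by
      have := Gf_mono hTS Y X hX1 ((i : ℤ) - N)
      push_cast
      rwa [show (i : ℤ) + 1 - N = (i : ℤ) - N + 1 by ring])
    (fun i => Gf_le hTm hSm Y X hY hX _)
    (fun i => by
      have := Gf_shift hST Y X ((i : ℤ) - N)
      push_cast
      rwa [show (i : ℤ) + 1 - N = (i : ℤ) - N + 1 by ring]) (N + N)
  have e0 : Gf T S Y X (((0 : ℕ) : ℤ) - N) = obsFieldLE T S Y 0 ⊔ MeasurableSpace.comap (S^[N]) X := by
    rw [Gf, Nat.cast_zero, zero_sub, iter_neg_nat]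
  have e1 : Gf T S Y X (((N + N : ℕ) : ℤ) - N) = obsFieldLE T S Y 0 ⊔ MeasurableSpace.comap (T^[N]) X := by
    rw [Gf, Nat.cast_add, add_sub_cancel_right, iter_nat]
  simp only [e0, e1] at hchain
  set R : Ω → ℝ := fun x => |g₁ N x| + |g₂ N x| with hR
  have hRi : Integrable R P := (hi₁ N).abs.add (hi₂ N).abs
  have hRint : ∫ x, R x ∂P < ε / 2 := by
    simp only [hR]
    rw [integral_add (hi₁ N).abs (hi₂ N).abs]
    linarith
  have q1 := ae_all_iterate hT' (fun k => (hg₁ N).2.1 (v k) (hv k))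
  have q2 := ae_all_iterate hT' (fun k => (hg₂ N).2.1 (v k) (hv k))
  filter_upwards [q1, q2, birk_upper P T hT R hRi _ hRint, hchain] with x a1 a2 a3 a4
  have a5 := a4.abs
  rw [abs_zero] at a5
  filter_upwards [a3, a5.eventually (gt_mem_nhds (show (0:ℝ) < ε / 2 by linarith))] with n b1 b2
  refine (avg_abs_le n _ (fun k => R (T^[k] x)) _ ?_).trans (add_le_add b1 b2.le |>.trans (by linarith))
  intro k
  have c1 := abs_le.mp ((a1 k).trans (le_abs_self _))
  have c2 := abs_le.mp ((a2 k).trans (le_abs_self _))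
  rw [abs_le]
  simp only [hR]
  constructor <;> linarith [c1.1, c1.2, c2.1, c2.2]


lemma switch_lim (P : Measure Ω) [IsProbabilityMeasure P] (F : Filtration ℕ m0) (h : Ω → ℝ)
    (hh : Integrable h P) (δ : ℝ)
    (hsw : ∀ᶠ m in atTop, ∀ B : Set Ω, MeasurableSet[F m] B → ∫ x in B, h x ∂P ≤ δ) :
    ∫ x, max ((P[h | ⨆ m, F m]) x) 0 ∂P ≤ δ := by
  have hlim := tendsto_eLpNorm_condExp (ℱ := F) (μ := P) h
  refine le_of_forall_pos_le_add fun ε hε => ?_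
  have hev := hlim.eventually (gt_mem_nhds (show (0 : ℝ≥0∞) < ENNReal.ofReal ε by simpa using hε))
  obtain ⟨m, hm1, hm2⟩ := (hsw.and hev).exists
  have hia : Integrable (P[h | F m]) P := integrable_condExp
  have hib : Integrable (P[h | ⨆ m, F m]) P := integrable_condExp
  have hm3 : ∫ x, |(P[h | F m]) x - (P[h | ⨆ m, F m]) x| ∂P ≤ ε := by
    have e1 : eLpNorm (P[h | F m] - P[h | ⨆ m, F m]) 1 P
        = ENNReal.ofReal (∫ x, |(P[h | F m]) x - (P[h | ⨆ m, F m]) x| ∂P) := by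
      rw [eLpNorm_one_eq_lintegral_enorm,
        ← ofReal_integral_norm_eq_lintegral_enorm (hia.sub hib)]
      rfl
    rw [e1] at hm2
    exact ((ENNReal.ofReal_lt_ofReal_iff hε).mp hm2).le
  have hBm : MeasurableSet[F m] {x | 0 < (P[h | F m]) x} :=
    (stronglyMeasurable_condExp (m := F m) (μ := P) (f := h)).measurable measurableSet_Ioi
  have hmax : ∫ x, max ((P[h | F m]) x) 0 ∂P ≤ δ := by
    refine le_trans (le_of_eq ?_) (hm1 _ hBm)
    rw [← setIntegral_condExp (F.le m) hh hBm, ← integral_indicator (F.le m _ hBm)]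
    refine integral_congr_ae (ae_of_all _ fun x => ?_)
    by_cases hx : 0 < (P[h | F m]) x
    · rw [indicator_of_mem (by exact hx)]
      exact max_eq_left hx.le
    · rw [indicator_of_notMem (by exact hx)]
      exact max_eq_right (not_lt.mp hx)
  have hpos : ∀ f : Ω → ℝ, Integrable f P → Integrable (fun x => max (f x) 0) P :=
    fun f hf => hf.pos_part
  calc ∫ x, max ((P[h | ⨆ m, F m]) x) 0 ∂P
      ≤ ∫ x, (max ((P[h | F m]) x) 0 + |(P[h | F m]) x - (P[h | ⨆ m, F m]) x|) ∂P := by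
        refine integral_mono (hpos _ hib) ((hpos _ hia).add (hia.sub hib).abs) fun x => ?_
        have := neg_abs_le ((P[h | F m]) x - (P[h | ⨆ m, F m]) x)
        refine max_le ?_ (by positivity)
        have := le_max_left ((P[h | F m]) x) 0
        linarith
    _ = _ + _ := integral_add (hpos _ hia) (hia.sub hib).abs
    _ ≤ δ + ε := add_le_add hmax hm3

/-- The filtration `𝒴_{-m,0}`. -/
def obsFilt {T S : Ω → Ω} (hT : Measurable[m0] T) (hS : Measurable[m0] S)
    (Y : MeasurableSpace Ω) (hY : Y ≤ m0) : Filtration ℕ m0 where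
  seq m := obsField T S Y (-(m : ℤ)) 0
  mono' m m' h := obsField_mono T S Y 0 (by omega)
  le' m := obsField_le hT hS Y hY _ 0

lemma switch_step (P : Measure Ω) [IsProbabilityMeasure P]
    {T S : Ω → Ω} (hT : Measurable[m0] T) (hS : Measurable[m0] S)
    (ℓ : U → Ω → ℝ) (hℓ : Measurable fun p : U × Ω => ℓ p.1 p.2)
    (Λ : Ω → ℝ) (hΛ : Integrable Λ P) (hdom : ∀ u ω, |ℓ u ω| ≤ Λ ω)
    (Y : MeasurableSpace Ω) (hY : Y ≤ m0) (c δ : ℝ)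
    (hc : ∀ v ∈ (Un T S Y 0 : Set (Ω → U)), c ≤ ∫ x, lossAt T S ℓ 0 v x ∂P)
    (w v : Ω → U) (hw : w ∈ (Un T S Y 0 : Set (Ω → U))) (hv : v ∈ (Un T S Y 0 : Set (Ω → U)))
    (hwc : ∫ x, lossAt T S ℓ 0 w x ∂P ≤ c + δ) :
    ∫ x, max ((P[lossAt T S ℓ 0 w | obsFieldLE T S Y 0]) x
      - (P[lossAt T S ℓ 0 v | obsFieldLE T S Y 0]) x) 0 ∂P ≤ δ := by
  have hwi := loss_integrable (T := T) (S := S) ℓ hℓ Λ hΛ hdom w (Un_measurable hT hS Y hY w hw)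
  have hvi := loss_integrable (T := T) (S := S) ℓ hℓ Λ hΛ hdom v (Un_measurable hT hS Y hY v hv)
  obtain ⟨mw, hmw⟩ := Un_nat Y w hw
  obtain ⟨mv, hmv⟩ := Un_nat Y v hv
  have key := switch_lim P (obsFilt hT hS Y hY) (lossAt T S ℓ 0 w - lossAt T S ℓ 0 v)
    (hwi.sub hvi) δ (by
      filter_upwards [eventually_ge_atTop (max mw mv)] with m hm B hB
      classical
      have hw' : Measurable[obsField T S Y (-(m : ℤ)) 0] w :=
        hmw.mono (obsField_mono T S Y 0 (by have := le_max_left mw mv; omega)) le_rfl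
      have hv' : Measurable[obsField T S Y (-(m : ℤ)) 0] v :=
        hmv.mono (obsField_mono T S Y 0 (by have := le_max_right mw mv; omega)) le_rfl
      have hB' : MeasurableSet[obsField T S Y (-(m : ℤ)) 0] B := hB
      have hB0 : MeasurableSet[m0] B := obsField_le hT hS Y hY _ 0 _ hB'
      have hs : B.piecewise v w ∈ (Un T S Y 0 : Set (Ω → U)) :=
        mem_Un Y _ m (hv'.piecewise hB' hw')
      have h1 := hc _ hs
      have h2 : ∫ x, lossAt T S ℓ 0 (B.piecewise v w) x ∂P
          = ∫ x, lossAt T S ℓ 0 w x ∂P - ∫ x in B, (lossAt T S ℓ 0 w - lossAt T S ℓ 0 v) x ∂P := by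
        rw [← integral_indicator hB0, ← integral_sub hwi ((hwi.sub hvi).indicator hB0)]
        refine integral_congr_ae (ae_of_all _ fun x => ?_)
        by_cases hx : x ∈ B
        · simp [lossAt, hx]
        · simp [lossAt, hx]
      linarith)
  have e : ⨆ m, (obsFilt hT hS Y hY : Filtration ℕ m0) m = obsFieldLE T S Y 0 := iSup_obsField T S Y
  rw [e] at key
  refine le_trans (le_of_eq ?_) key
  refine integral_congr_ae ?_
  filter_upwards [condExp_sub hwi hvi (obsFieldLE T S Y 0)] with x hx
  rw [hx]; rfl

/-- Minimizing sequence argument in abstract form. -/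
lemma limsup_abs {ι : Type*} (P : Measure Ω) (S₀ : Set ι) (f : ι → Ω → ℝ) (g B : Ω → ℝ)
    (hg : IsEssInfFam P S₀ f g) (hB : Integrable B P)
    (hfi : ∀ i ∈ S₀, Integrable (f i) P)
    (hfm : ∀ i ∈ S₀, Measurable (f i))
    (hfB : ∀ i ∈ S₀, ∀ᵐ x ∂P, |f i x| ≤ B x)
    (w : ℕ → ι) (hw : ∀ j, w j ∈ S₀)
    (hstep : ∀ j, ∀ i ∈ S₀, ∫ x, max (f (w j) x - f i x) 0 ∂P ≤ (1 / 2 : ℝ) ^ j) :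
    Tendsto (fun j => ∫ x, f (w j) x ∂P) atTop (𝓝 (∫ x, g x ∂P)) := by
  obtain ⟨hgm, hlow, hgr⟩ := hg
  have hb : ∀ᵐ x ∂P, ∀ j, |f (w j) x| ≤ B x := ae_all_iff.mpr fun j => hfB _ (hw j)
  have hup : ∀ᵐ x ∂P, limsup (fun j => f (w j) x) atTop ≤ g x := by
    refine hgr (fun x => limsup (fun j => f (w j) x) atTop)
      (Measurable.limsup fun j => hfm _ (hw j)) fun i hi => ?_
    have h0 := ae_tendsto_zero_of_sum P (fun j x => max (f (w j) x - f i x) 0)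
      (fun j => ((hfi _ (hw j)).sub (hfi i hi)).pos_part)
      (fun j => ae_of_all _ fun x => le_max_right _ _) (fun j => hstep j i hi)
    filter_upwards [h0, hb] with x hx hbx
    have hx' := hx.add_const (f i x)
    rw [zero_add] at hx'
    rw [← hx'.limsup_eq]
    refine limsup_le_limsup (Eventually.of_forall fun j => ?_) ?_ hx'.isBoundedUnder_le
    · have := le_max_left (f (w j) x - f i x) 0
      simp only
      linarith
    · exact (isBoundedUnder_of ⟨- B x, fun j => (abs_le.mp (hbx j)).1⟩ :
        IsBoundedUnder (· ≥ ·) atTop (fun j => f (w j) x)).isCoboundedUnder_le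
  refine tendsto_integral_of_dominated_convergence B
    (fun j => (hfi _ (hw j)).aestronglyMeasurable) hB
    (fun j => by simpa [Real.norm_eq_abs] using hfB _ (hw j)) ?_
  filter_upwards [hup, hb, ae_all_iff.mpr fun j => hlow _ (hw j)] with x h1 h2 h3
  have bu : IsBoundedUnder (· ≤ ·) atTop (fun j => f (w j) x) :=
    isBoundedUnder_of ⟨B x, fun j => (abs_le.mp (h2 j)).2⟩
  have bl : IsBoundedUnder (· ≥ ·) atTop (fun j => f (w j) x) :=
    isBoundedUnder_of ⟨- B x, fun j => (abs_le.mp (h2 j)).1⟩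
  refine tendsto_of_le_liminf_of_limsup_le ?_ h1 bu bl
  exact le_liminf_of_le bu.isCoboundedUnder_ge (Eventually.of_forall h3)

lemma near_opt [Nonempty U] (P : Measure Ω) [IsProbabilityMeasure P]
    {T S : Ω → Ω} (hT : Measurable[m0] T) (hS : Measurable[m0] S)
    (ℓ : U → Ω → ℝ) (hℓ : Measurable fun p : U × Ω => ℓ p.1 p.2)
    (Λ : Ω → ℝ) (hΛ : Integrable Λ P) (hdom : ∀ u ω, |ℓ u ω| ≤ Λ ω)
    (Y : MeasurableSpace Ω) (hY : Y ≤ m0) (g : Ω → ℝ)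
    (hg : IsEssInfFam P (Un T S Y 0 : Set (Ω → U))
      (fun v => P[lossAt T S ℓ 0 v | obsFieldLE T S Y 0]) g) (ε : ℝ) (hε : 0 < ε) :
    ∃ v ∈ (Un T S Y 0 : Set (Ω → U)), ∫ x, lossAt T S ℓ 0 v x ∂P ≤ ∫ x, g x ∂P + ε := by
  obtain ⟨u0⟩ := ‹Nonempty U›
  have hli : ∀ w ∈ (Un T S Y 0 : Set (Ω → U)), Integrable (lossAt T S ℓ 0 w) P := fun w hw =>
    loss_integrable ℓ hℓ Λ hΛ hdom w (Un_measurable hT hS Y hY w hw)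
  set A : Set ℝ := (fun v => ∫ x, lossAt T S ℓ 0 v x ∂P) '' (Un T S Y 0 : Set (Ω → U)) with hA
  have hAne : A.Nonempty := ⟨_, _, const_mem_Un T S Y u0, rfl⟩
  have hAb : BddBelow A := by
    refine ⟨- ∫ x, Λ x ∂P, ?_⟩
    rintro _ ⟨v, hv, rfl⟩
    rw [← integral_neg]
    exact integral_mono hΛ.neg (hli v hv) fun x => (abs_le.mp (hdom _ _)).1
  have hex : ∀ j : ℕ, ∃ v ∈ (Un T S Y 0 : Set (Ω → U)),
      ∫ x, lossAt T S ℓ 0 v x ∂P ≤ sInf A + (1 / 2 : ℝ) ^ j := by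
    intro j
    obtain ⟨_, ⟨v, hv, rfl⟩, h⟩ := exists_lt_of_csInf_lt hAne
      (show sInf A < sInf A + (1 / 2 : ℝ) ^ j by linarith [show (0:ℝ) < (1/2)^j by positivity])
    exact ⟨v, hv, h.le⟩
  choose w hw hwj using hex
  have hle := obsFieldLE_le hT hS Y hY 0
  have hlim := limsup_abs P (Un T S Y 0 : Set (Ω → U))
    (fun v => P[lossAt T S ℓ 0 v | obsFieldLE T S Y 0]) g (P[Λ | obsFieldLE T S Y 0]) hg
    integrable_condExp (fun i _ => integrable_condExp)
    (fun i _ => stronglyMeasurable_condExp.measurable.mono hle le_rfl)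
    (fun i hi => abs_condExp_le' P _ _ Λ (hli i hi) hΛ (ae_of_all _ fun x => hdom _ _))
    w hw
    (fun j i hi => switch_step P hT hS ℓ hℓ Λ hΛ hdom Y hY (sInf A) _
      (fun v hv => csInf_le hAb ⟨v, hv, rfl⟩) (w j) i (hw j) hi (hwj j))
  obtain ⟨j, hj⟩ := (hlim.eventually
    (gt_mem_nhds (show ∫ x, g x ∂P < ∫ x, g x ∂P + ε by linarith))).exists
  rw [integral_condExp hle] at hj
  exact ⟨w j, hw j, hj.le⟩

lemma upper_det (a e b : ℕ → ℝ) (c : ℝ) (K : ℕ)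
    (h1 : Tendsto (fun n : ℕ => (n : ℝ)⁻¹ * ∑ k ∈ Finset.Icc 1 n, (a k - e k)) atTop (𝓝 0))
    (h2 : ∀ k, K ≤ k → e k ≤ b k)
    (h3 : ∀ᶠ n : ℕ in atTop, (n : ℝ)⁻¹ * ∑ k ∈ Finset.Icc 1 n, b k ≤ c) (δ : ℝ) (hδ : 0 < δ) :
    ∀ᶠ n : ℕ in atTop, (n : ℝ)⁻¹ * ∑ k ∈ Finset.Icc 1 n, a k ≤ c + δ := by
  have hC : Tendsto (fun n : ℕ => (n : ℝ)⁻¹ * ∑ k ∈ Finset.range K, |e k - b k|) atTop (𝓝 0) := by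
    simpa using (tendsto_inv_atTop_nhds_zero_nat (𝕜 := ℝ)).mul_const
      (∑ k ∈ Finset.range K, |e k - b k|)
  filter_upwards [h3, h1.eventually (gt_mem_nhds (show (0:ℝ) < δ / 2 by linarith)),
    hC.eventually (gt_mem_nhds (show (0:ℝ) < δ / 2 by linarith))] with n n1 n2 n3
  have hs : ∑ k ∈ Finset.Icc 1 n, (e k - b k) ≤ ∑ k ∈ Finset.range K, |e k - b k| := by
    calc ∑ k ∈ Finset.Icc 1 n, (e k - b k)
        ≤ ∑ k ∈ Finset.Icc 1 n, (if k ∈ Finset.range K then |e k - b k| else 0) := by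
          refine Finset.sum_le_sum fun k _ => ?_
          split_ifs with hk
          · exact le_abs_self _
          · have := h2 k (by simpa using hk)
            linarith
      _ = ∑ k ∈ Finset.Icc 1 n ∩ Finset.range K, |e k - b k| := Finset.sum_ite_mem _ _ _
      _ ≤ _ := Finset.sum_le_sum_of_subset_of_nonneg Finset.inter_subset_right
          fun _ _ _ => abs_nonneg _
  have h0 : (0 : ℝ) ≤ (n : ℝ)⁻¹ := by positivity
  have hs' := mul_le_mul_of_nonneg_left hs h0
  rw [Finset.sum_sub_distrib, mul_sub] at hs' n2
  linarith

lemma lower_det (a e g : ℕ → ℝ) (L : ℝ)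
    (h1 : Tendsto (fun n : ℕ => (n : ℝ)⁻¹ * ∑ k ∈ Finset.Icc 1 n, (a k - e k)) atTop (𝓝 0))
    (h2 : ∀ k, g k ≤ e k)
    (h3 : Tendsto (fun n : ℕ => (n : ℝ)⁻¹ * ∑ k ∈ Finset.Icc 1 n, g k) atTop (𝓝 L))
    (δ : ℝ) (hδ : 0 < δ) :
    ∀ᶠ n : ℕ in atTop, L - δ ≤ (n : ℝ)⁻¹ * ∑ k ∈ Finset.Icc 1 n, a k := by
  have h4 := h1.add h3
  rw [zero_add] at h4
  filter_upwards [h4.eventually (lt_mem_nhds (show L - δ < L by linarith))] with n hn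
  have h0 : (0 : ℝ) ≤ (n : ℝ)⁻¹ := by positivity
  have hs := mul_le_mul_of_nonneg_left
    (Finset.sum_le_sum fun k (_ : k ∈ Finset.Icc 1 n) => h2 k) h0
  rw [Finset.sum_sub_distrib, mul_sub] at hn
  linarith

lemma strat_exists (T S : Ω → Ω) (Y : MeasurableSpace Ω) (u0 : U) (w : ℕ → Ω → U) (mm : ℕ → ℕ)
    (hw : ∀ j, Measurable[obsField T S Y (-(mm j : ℤ)) 0] (w j)) :
    ∃ (vs : ℕ → Ω → U) (J : ℕ → ℕ), (∀ k : ℕ, Measurable[obsField T S Y (-(k : ℤ)) 0] (vs k)) ∧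
      ∀ j, ∃ K, ∀ k, K ≤ k → j ≤ J k ∧ vs k = w (J k) := by
  refine ⟨fun k => if mm (Nat.findGreatest (fun j => mm j ≤ k) k) ≤ k then
    w (Nat.findGreatest (fun j => mm j ≤ k) k) else fun _ => u0,
    fun k => Nat.findGreatest (fun j => mm j ≤ k) k, fun k => ?_, fun j => ?_⟩
  · dsimp only
    split_ifs with h
    · exact (hw _).mono (obsField_mono T S Y 0 (by omega)) le_rfl
    · exact measurable_const
  · refine ⟨max j (mm j), fun k hk => ⟨?_, ?_⟩⟩
    · exact Nat.le_findGreatest (le_of_max_le_left hk) (le_of_max_le_right hk)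
    · dsimp only
      rw [if_pos]
      exact Nat.findGreatest_spec (P := fun j => mm j ≤ k) (le_of_max_le_left hk)
        (le_of_max_le_right hk)

lemma comap_obsField_T {T S : Ω → Ω} (hST : Function.LeftInverse S T) (Y : MeasurableSpace Ω)
    (k : ℕ) : MeasurableSpace.comap (T^[k]) (obsField T S Y (-(k : ℤ)) 0) ≤
      obsField T S Y 0 k := by
  simp only [obsField, MeasurableSpace.comap_iSup, MeasurableSpace.comap_comp]
  refine iSup₂_le fun j hj => ?_
  rw [iter_comp_T_iterate hST]
  exact le_iSup₂_of_le (f := fun (j : ℤ) (_ : j ∈ Set.Icc (0:ℤ) (k:ℤ)) =>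
    MeasurableSpace.comap (iter T S j) Y) (j + k)
    ⟨by have := hj.1; omega, by have := hj.2; omega⟩ le_rfl

lemma comap_obsField_S {T S : Ω → Ω} (hST : Function.LeftInverse S T)
    (hTS : Function.RightInverse S T) (Y : MeasurableSpace Ω)
    (k : ℕ) : MeasurableSpace.comap (S^[k]) (obsField T S Y 0 k) ≤
      obsField T S Y (-(k : ℤ)) 0 := by
  simp only [obsField, MeasurableSpace.comap_iSup, MeasurableSpace.comap_comp]
  refine iSup₂_le fun j hj => ?_
  rw [iter_comp_S_iterate hST hTS]
  exact le_iSup₂_of_le (f := fun (j : ℤ) (_ : j ∈ Set.Icc (-(k:ℤ)) 0) =>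
    MeasurableSpace.comap (iter T S j) Y) (j - k)
    ⟨by have := hj.1; omega, by have := hj.2; omega⟩ le_rfl

lemma meas_comp {m1 m2 : MeasurableSpace Ω} (f : Ω → Ω) (v : Ω → U) (hv : Measurable[m1] v)
    (h : MeasurableSpace.comap f m1 ≤ m2) : Measurable[m2] (v ∘ f) := by
  intro s hs
  exact h _ ⟨_, hv hs, rfl⟩

lemma avg_bdd (a b : ℕ → ℝ) (h : ∀ k, |a k| ≤ b k) (n : ℕ) :
    |(n : ℝ)⁻¹ * ∑ k ∈ Finset.Icc 1 n, a k| ≤ (n : ℝ)⁻¹ * ∑ k ∈ Finset.Icc 1 n, b k := by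
  have := avg_abs_le n a b (fun _ => 0) (by simpa using h)
  simpa using this

/-- Theorem 2.6, pathwise optimality: under the uniform martingale
convergence assumptions and the conditional mixing assumption relative to a σ-field `𝒳` with
`𝒳 ⊆ T⁻¹𝒳`, there exists a pathwise optimal strategy `u⋆` whose time-average loss converges
a.s. to the optimal long time-average loss `L⋆`. -/
theorem statement3
    {Ω U : Type*} [m0 : MeasurableSpace Ω] [MeasurableSpace U] [Nonempty U]
    (P : Measure Ω) [IsProbabilityMeasure P]
    (T S : Ω → Ω) (hT : Ergodic T P) (hS : MeasurePreserving S P P)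
    (hST : Function.LeftInverse S T) (hTS : Function.RightInverse S T)
    (ℓ : U → Ω → ℝ) (hℓ : Measurable fun p : U × Ω => ℓ p.1 p.2)
    (Λ : Ω → ℝ) (hΛ : Integrable Λ P) (hdom : ∀ u ω, |ℓ u ω| ≤ Λ ω)
    (Y : MeasurableSpace Ω) (hY : Y ≤ m0)
    (X : MeasurableSpace Ω) (hX : X ≤ m0) (hX1 : X ≤ MeasurableSpace.comap T X)
    (g₁ : ℕ → Ω → ℝ)
    (hg₁ : ∀ n : ℕ, IsEssSupFam P (Un T S Y 0 : Set (Ω → U))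
      (fun v ω =>
        |(P[lossAt T S ℓ 0 v | obsFieldLE T S Y 0 ⊔ MeasurableSpace.comap (T^[n]) X]) ω -
          lossAt T S ℓ 0 v ω|) (g₁ n))
    (hg₁0 : Tendsto (fun n : ℕ => ∫ ω, |g₁ n ω| ∂P) atTop (𝓝 0))
    (g₂ : ℕ → Ω → ℝ)
    (hg₂ : ∀ n : ℕ, IsEssSupFam P (Un T S Y 0 : Set (Ω → U))
      (fun v ω =>
        |(P[lossAt T S ℓ 0 v | obsFieldLE T S Y 0 ⊔ MeasurableSpace.comap (S^[n]) X]) ω -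
          (P[lossAt T S ℓ 0 v | tailField T S Y X]) ω|) (g₂ n))
    (hg₂0 : Tendsto (fun n : ℕ => ∫ ω, |g₂ n ω| ∂P) atTop (𝓝 0))
    (ginf₁ ginf₂ : Ω → ℝ)
    (hinf₁ : IsEssInfFam P (Un T S Y 0 : Set (Ω → U))
      (fun v => P[lossAt T S ℓ 0 v | obsFieldLE T S Y 0]) ginf₁)
    (hinf₂ : IsEssInfFam P (Un T S Y 0 : Set (Ω → U))
      (fun v => P[lossAt T S ℓ 0 v | tailField T S Y X]) ginf₂)
    (hL : ∫ ω, ginf₁ ω ∂P = ∫ ω, ginf₂ ω ∂P) :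
    ∃ us : ℕ → Ω → U, Admissible T S Y us ∧
      (∀ u : ℕ → Ω → U, Admissible T S Y u →
        ∀ᵐ ω ∂P, 0 ≤ Filter.liminf
          (fun n : ℕ => avgLoss T S ℓ u n ω - avgLoss T S ℓ us n ω) atTop) ∧
      ∀ᵐ ω ∂P, Tendsto (fun n : ℕ => avgLoss T S ℓ us n ω) atTop (𝓝 (∫ ω, ginf₁ ω ∂P)) := by
  have hT' := hT.toMeasurePreserving
  have hTm := mp_meas hT'
  have hSm := mp_meas hS
  have hU := ‹Nonempty U›
  obtain ⟨u0⟩ := hU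
  have hne : (Un T S Y 0 : Set (Ω → U)).Nonempty := ⟨_, const_mem_Un T S Y u0⟩
  have hli : ∀ w ∈ (Un T S Y 0 : Set (Ω → U)), Integrable (lossAt T S ℓ 0 w) P := fun w hw =>
    loss_integrable ℓ hℓ Λ hΛ hdom w (Un_measurable hTm hSm Y hY w hw)
  have htail := tailField_le hTm hSm Y X hY hX
  have hi₂ : Integrable ginf₂ P := essInf_integrable P _ hne _ ginf₂ (P[Λ | tailField T S Y X])
    hinf₂ integrable_condExp (fun w hw => abs_condExp_le' P _ _ Λ (hli w hw) hΛ
      (ae_of_all _ fun x => hdom _ _))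
  have hkey := key P T S hT hS hST hTS ℓ hℓ Λ hΛ hdom Y hY X hX hX1 g₁ hg₁ hg₁0 g₂ hg₂ hg₂0
  -- the lower bound
  have hlower : ∀ v : ℕ → Ω → U, (∀ k, v k ∈ (Un T S Y 0 : Set (Ω → U))) →
      ∀ᵐ x ∂P, ∀ δ : ℝ, 0 < δ → ∀ᶠ n : ℕ in atTop, ∫ ω, ginf₁ ω ∂P - δ ≤
        (n : ℝ)⁻¹ * ∑ k ∈ Finset.Icc 1 n, lossAt T S ℓ 0 (v k) (T^[k] x) := by
    intro v hv
    have q := ae_all_iterate hT' (fun k => hinf₂.2.1 (v k) (hv k))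
    filter_upwards [hkey v hv, q, birk P T hT ginf₂ hi₂] with x a1 a2 a3 δ hδ
    rw [hL]
    exact lower_det _ _ _ _ a1 a2 a3 δ hδ
  -- the strategy
  have hex : ∀ j : ℕ, ∃ v ∈ (Un T S Y 0 : Set (Ω → U)),
      ∫ x, lossAt T S ℓ 0 v x ∂P ≤ ∫ x, ginf₁ x ∂P + (1 / 2 : ℝ) ^ j := fun j =>
    near_opt P hTm hSm ℓ hℓ Λ hΛ hdom Y hY ginf₁ hinf₁ _ (by positivity)
  choose w hw hwj using hex
  choose mm hmm using fun j => Un_nat Y (w j) (hw j)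
  obtain ⟨vs, J, hvs, hJ⟩ := strat_exists T S Y u0 w mm hmm
  have hvsU : ∀ k, vs k ∈ (Un T S Y 0 : Set (Ω → U)) := fun k => mem_Un Y _ k (hvs k)
  have hconv : ∀ᵐ ω ∂P, Tendsto (fun n : ℕ => avgLoss T S ℓ (fun k => vs k ∘ T^[k]) n ω) atTop
      (𝓝 (∫ ω, ginf₁ ω ∂P)) := by
    have h0 := tendsto_of_eps P
      (fun n x => avgLoss T S ℓ (fun k => vs k ∘ T^[k]) n x - ∫ ω, ginf₁ ω ∂P) (by
        intro ε hε
        obtain ⟨J₀, H, hHi, hHint, hH⟩ := envelope P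
          (fun j x => (P[lossAt T S ℓ 0 (w j) | tailField T S Y X]) x - ginf₂ x)
          (fun j => integrable_condExp.sub hi₂)
          (fun j => by
            filter_upwards [hinf₂.2.1 (w j) (hw j)] with x hx
            exact sub_nonneg.mpr hx)
          (fun j => by
            rw [integral_sub integrable_condExp hi₂, integral_condExp htail, ← hL]
            have := hwj j
            linarith) (ε / 4) (by linarith)
        obtain ⟨K, hK⟩ := hJ J₀
        have hGi : Integrable (fun x => ginf₂ x + H x) P := hi₂.add hHi
        have hGint : ∫ x, (ginf₂ x + H x) ∂P < ∫ ω, ginf₁ ω ∂P + ε / 2 := by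
          rw [integral_add hi₂ hHi, hL]
          linarith
        have q := ae_all_iterate hT' (p := fun _ x => ∀ j, J₀ ≤ j →
          (P[lossAt T S ℓ 0 (w j) | tailField T S Y X]) x - ginf₂ x ≤ H x) (fun _ => hH)
        filter_upwards [hlower vs hvsU, hkey vs hvsU, q, birk_upper P T hT _ hGi _ hGint]
          with x a1 a2 a3 a4
        have hup := upper_det _ _ (fun k => ginf₂ (T^[k] x) + H (T^[k] x)) _ K a2 (by
          intro k hk
          obtain ⟨b1, b2⟩ := hK k hk
          have := a3 k (J k) b1
          rw [b2]
          linarith) a4 (ε / 2) (by linarith)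
        filter_upwards [hup, a1 ε hε] with n n1 n2
        rw [abs_le]
        change _ ≤ (n : ℝ)⁻¹ * ∑ k ∈ Finset.Icc 1 n, lossAt T S ℓ 0 (vs k) (T^[k] x) - _ ∧
          (n : ℝ)⁻¹ * ∑ k ∈ Finset.Icc 1 n, lossAt T S ℓ 0 (vs k) (T^[k] x) - _ ≤ _
        constructor <;> linarith)
    filter_upwards [h0] with x hx
    simpa using hx.add_const (∫ ω, ginf₁ ω ∂P)
  refine ⟨fun k => vs k ∘ T^[k], fun k _ => meas_comp _ _ (hvs k) (comap_obsField_T hST Y k),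
    fun u hu => ?_, hconv⟩
  -- pathwise optimality
  have hvU : ∀ k : ℕ, (if 1 ≤ k then u k ∘ S^[k] else fun _ => u0) ∈
      (Un T S Y 0 : Set (Ω → U)) := by
    intro k
    split_ifs with hk
    · exact mem_Un Y _ k (meas_comp _ _ (hu k hk) (comap_obsField_S hST hTS Y k))
    · exact const_mem_Un T S Y u0
  filter_upwards [hlower _ hvU, hconv, birk P T hT Λ hΛ] with x a1 a2 a3
  have hle : ∀ n : ℕ, avgLoss T S ℓ u n x = (n : ℝ)⁻¹ * ∑ k ∈ Finset.Icc 1 n,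
      lossAt T S ℓ 0 (if 1 ≤ k then u k ∘ S^[k] else fun _ => u0) (T^[k] x) := by
    intro n
    unfold avgLoss
    congr 1
    refine Finset.sum_congr rfl fun k hk => ?_
    rw [if_pos (Finset.mem_Icc.mp hk).1]
    change ℓ (u k x) (T^[k] x) = ℓ (u k (S^[k] (T^[k] x))) (T^[k] x)
    rw [(Function.LeftInverse.iterate hST k) x]
  have hbu : IsBoundedUnder (· ≤ ·) atTop (fun n => avgLoss T S ℓ u n x) :=
    a3.isBoundedUnder_le.mono_le (Eventually.of_forall fun n => by
      have := avg_bdd (fun k => lossAt T S ℓ (k : ℤ) (u k) x) (fun k => Λ (T^[k] x))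
        (fun k => hdom _ _) n
      exact (abs_le.mp this).2)
  have hbd : IsBoundedUnder (· ≤ ·) atTop
      (fun n => avgLoss T S ℓ u n x - avgLoss T S ℓ (fun k => vs k ∘ T^[k]) n x) := by
    simp only [sub_eq_add_neg]
    exact isBoundedUnder_le_add hbu a2.neg.isBoundedUnder_le
  refine le_of_forall_pos_le_add fun ε hε => ?_
  have := le_liminf_of_le (a := -ε) hbd.isCoboundedUnder_ge (by
    filter_upwards [a1 (ε / 2) (by linarith), a2.eventually
      (gt_mem_nhds (show ∫ ω, ginf₁ ω ∂P < ∫ ω, ginf₁ ω ∂P + ε / 2 by linarith))] with n n1 n2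
    rw [← hle n] at n1
    linarith)
  linarith

end ErgodicDecisions
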